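/- Let (f_n)_{n≥0} be a uniformly attracting sequence of automorphisms of ℂ² with constants 0<C<D<1. Suppose every f_n has order of contact k for some integer k≥2, the derivative Df_n(0) is a diagonal matrix for every n, and D^{k+1} < C. Then the basin of attraction Ω_{(f_n)} is biholomorphic to ℂ². -/

import Mathlib

open Set Filter Metric Topology Asymptotics

noncomputable section

/-- An automorphism of ℂ²: a biholomorphic map of ℂ² onto itself. -/
def IsAutomorphism (f : (ℂ × ℂ) → (ℂ × ℂ)) : Prop :=
  AnalyticOn ℂ f Set.univ ∧
    ∃ g : (ℂ × ℂ) → (ℂ × ℂ), AnalyticOn ℂ g Set.univ ∧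
      Function.LeftInverse g f ∧ Function.RightInverse g f

/-- `seqComp f n = f n ∘ ⋯ ∘ f 0`. -/
def seqComp (f : ℕ → (ℂ × ℂ) → (ℂ × ℂ)) : ℕ → (ℂ × ℂ) → (ℂ × ℂ)
  | 0 => f 0
  | n + 1 => f (n + 1) ∘ seqComp f n

/-- The basin of attraction of the sequence `(f n)`. -/
def basin (f : ℕ → (ℂ × ℂ) → (ℂ × ℂ)) : Set (ℂ × ℂ) :=
  {z | Tendsto (fun n => seqComp f n z) atTop (𝓝 0)}

/-- A sequence of maps fixing the origin is uniformly attracting with constants `C < D`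
if `C‖z‖ ≤ ‖f n z‖ ≤ D‖z‖` on the open unit ball. -/
def UniformlyAttracting (f : ℕ → (ℂ × ℂ) → (ℂ × ℂ)) (C D : ℝ) : Prop :=
  (∀ n, f n 0 = 0) ∧
    ∀ n, ∀ z : ℂ × ℂ, ‖z‖ < 1 → C * ‖z‖ ≤ ‖f n z‖ ∧ ‖f n z‖ ≤ D * ‖z‖

/-- `U` is biholomorphic to `V`. -/
def BiholomorphicTo (U V : Set (ℂ × ℂ)) : Prop :=
  ∃ Φ Ψ : (ℂ × ℂ) → (ℂ × ℂ), AnalyticOn ℂ Φ U ∧ AnalyticOn ℂ Ψ V ∧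
    MapsTo Φ U V ∧ MapsTo Ψ V U ∧
    (∀ z ∈ U, Ψ (Φ z) = z) ∧ (∀ w ∈ V, Φ (Ψ w) = w)

/-- `f` has order of contact `k`: `f(z) = ℓ(z) + O(‖z‖^k)` near `0` with `ℓ` linear. -/
def OrderOfContact (f : (ℂ × ℂ) → (ℂ × ℂ)) (k : ℕ) : Prop :=
  ∃ l : (ℂ × ℂ) →L[ℂ] (ℂ × ℂ),
    (fun z => f z - l z) =O[𝓝 (0 : ℂ × ℂ)] fun z => ‖z‖ ^ k

/-- Projection of `ℂ` to the closed disc of radius `r`. -/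
def discRetract (r : ℝ) (z : ℂ) : ℂ := ((r / max r ‖z‖ : ℝ) : ℂ) * z

lemma continuous_discRetract {r : ℝ} (hr : 0 < r) : Continuous (discRetract r) := by
  unfold discRetract
  have : ∀ z : ℂ, max r ‖z‖ ≠ 0 := fun z => (lt_max_of_lt_left hr).ne'
  fun_prop (disch := assumption)

lemma norm_discRetract_le {r : ℝ} (hr : 0 < r) (z : ℂ) : ‖discRetract r z‖ ≤ r := by
  have h : 0 < max r ‖z‖ := lt_max_of_lt_left hr
  rw [discRetract, norm_mul, Complex.norm_real, Real.norm_eq_abs, abs_of_pos (by positivity),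
    div_mul_eq_mul_div, div_le_iff₀ h]
  gcongr
  exact le_max_right _ _

lemma discRetract_of_norm_le {r : ℝ} (hr : 0 < r) {z : ℂ} (hz : ‖z‖ ≤ r) :
    discRetract r z = z := by
  rw [discRetract, max_eq_left hz, div_self hr.ne']; simp

/-- Integration over a circle, as a continuous linear functional. -/
def circleIntegralCLM (r : ℝ) (hr : 0 ≤ r) : C(sphere (0 : ℂ) r, ℂ) →L[ℂ] ℂ :=
  LinearMap.mkContinuous
    { toFun := fun φ => ∫ θ in (0 : ℝ)..2 * Real.pi,
        deriv (circleMap 0 r) θ * φ ⟨circleMap 0 r θ, circleMap_mem_sphere 0 hr θ⟩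
      map_add' := fun φ ψ => by
        rw [← intervalIntegral.integral_add]
        · simp [mul_add]
        all_goals
          apply Continuous.intervalIntegrable
          simp only [deriv_circleMap]
          fun_prop
      map_smul' := fun c φ => by
        rw [RingHom.id_apply, smul_eq_mul, ← intervalIntegral.integral_const_mul]
        congr 1; ext θ; simp; ring }
    (r * |2 * Real.pi - 0|) (fun φ => by
      have := intervalIntegral.norm_integral_le_of_norm_le_const (a := 0) (b := 2 * Real.pi)
        (C := r * ‖φ‖) (f := fun θ : ℝ =>
        deriv (circleMap 0 r) θ * φ ⟨circleMap 0 r θ, circleMap_mem_sphere 0 hr θ⟩) (fun θ _ => by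
          rw [norm_mul]
          gcongr
          · simp [abs_of_nonneg hr]
          · exact φ.norm_coe_le_norm _)
      calc _ ≤ _ := this
        _ = _ := by ring)

lemma circleIntegralCLM_apply {r : ℝ} (hr : 0 ≤ r) (φ : C(sphere (0 : ℂ) r, ℂ)) (ψ : ℂ → ℂ)
    (h : ∀ z : sphere (0 : ℂ) r, φ z = ψ z) :
    circleIntegralCLM r hr φ = ∮ z in C(0, r), ψ z := by
  simp [circleIntegralCLM, circleIntegral, h]

/-- **Osgood's lemma** on a bidisc. -/
theorem analyticOnNhd_of_separately_differentiable {f : ℂ × ℂ → ℂ} {R : ℝ}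
    (hc : ContinuousOn f (ball 0 R))
    (h1 : ∀ w, ‖w‖ < R → DifferentiableOn ℂ (fun z => f (z, w)) (ball 0 R))
    (h2 : ∀ z, ‖z‖ < R → DifferentiableOn ℂ (fun w => f (z, w)) (ball 0 R)) :
    AnalyticOnNhd ℂ f (ball 0 R) := by
  rintro ⟨z₀, w₀⟩ hx
  rw [mem_ball_zero_iff] at hx
  obtain ⟨r, hxr, hrR⟩ := exists_between hx
  have hr : 0 < r := (norm_nonneg _).trans_lt hxr
  obtain ⟨hz₀, hw₀⟩ : ‖z₀‖ < r ∧ ‖w₀‖ < r := by simpa [Prod.norm_def] using hxr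
  have hmem : ∀ z w : ℂ, ‖z‖ ≤ r → ‖w‖ ≤ r → (z, w) ∈ ball (0 : ℂ × ℂ) R := by
    intro z w hz hw
    rw [mem_ball_zero_iff, Prod.norm_def]
    exact (max_le hz hw).trans_lt hrR
  have hsph : ∀ w : sphere (0 : ℂ) r, ‖(w : ℂ)‖ = r := fun w => by simp
  have hdR : closure (ball (0 : ℂ) r) ⊆ ball 0 R :=
    (closure_ball_subset_closedBall).trans (closedBall_subset_ball hrR)
  let F : C(ℂ, C(sphere (0 : ℂ) r, ℂ)) := ContinuousMap.curry
    ⟨fun p => f (discRetract r p.1, p.2), by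
      refine hc.comp_continuous ?_ fun p => hmem _ _ (norm_discRetract_le hr _) (hsph _).le
      exact ((continuous_discRetract hr).comp continuous_fst).prodMk (by fun_prop)⟩
  have hF : ∀ z w, F z w = f (discRetract r z, w) := fun z w => rfl
  let G : ℂ → C(sphere (0 : ℂ) r, ℂ) :=
    fun z => (2 * Real.pi * Complex.I : ℂ)⁻¹ • ∮ ζ in C(0, r), (ζ - z)⁻¹ • F ζ
  have hGan : AnalyticAt ℂ G z₀ := by
    lift r to NNReal using hr.le
    have := hasFPowerSeriesOn_cauchy_integral (f := F) (c := 0) (R := r)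
      (F.continuous.continuousOn.circleIntegrable r.2) (by exact_mod_cast hr)
    refine this.analyticOnNhd z₀ ?_
    simpa using hz₀
  have hG : ∀ z, ‖z‖ < r → ∀ w, G z w = f (z, w) := by
    intro z hz w
    have hd : DiffContOnCl ℂ (fun z => f (z, w)) (ball 0 r) :=
      ((h1 w (by rw [hsph]; exact hrR)).mono hdR).diffContOnCl
    rw [← hd.two_pi_i_inv_smul_circleIntegral_sub_inv_smul (mem_ball_zero_iff.2 hz)]
    simp only [G, ContinuousMap.smul_apply]
    congr 1
    simp only [circleIntegral]
    let ev : C(sphere (0 : ℂ) r, ℂ) →L[ℂ] ℂ := ContinuousMap.evalCLM ℂ w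
    have hcomm := ev.intervalIntegral_comp_comm (a := 0)
      (b := 2 * Real.pi) (μ := MeasureTheory.volume)
      (f := fun θ : ℝ => deriv (circleMap 0 r) θ • (circleMap 0 r θ - z)⁻¹ • F (circleMap 0 r θ)) ?_
    · refine hcomm.symm.trans ?_
      congr 1
      ext θ
      simp only [ev, ContinuousMap.evalCLM_apply, ContinuousMap.smul_apply, hF]
      rw [discRetract_of_norm_le hr (by simp [abs_of_pos hr])]
    · apply Continuous.intervalIntegrable
      have : ∀ θ, circleMap 0 r θ - z ≠ 0 := fun θ h => by
        rw [sub_eq_zero] at h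
        rw [← h] at hz
        simp [abs_of_pos hr] at hz
      simp only [deriv_circleMap]
      fun_prop (disch := assumption)
  let u : C(sphere (0 : ℂ) r, ℂ) := ⟨fun w => w, by fun_prop⟩
  let k : ℂ → C(sphere (0 : ℂ) r, ℂ) := fun w => Ring.inverse (u - algebraMap ℂ _ w)
  have hne : ∀ w, ‖w‖ < r → ∀ v : sphere (0 : ℂ) r, (v : ℂ) - w ≠ 0 := by
    intro w hw v h
    rw [sub_eq_zero] at h
    rw [← h, hsph] at hw
    exact lt_irrefl _ hw
  have hunit : ∀ w, ‖w‖ < r → ∃ U : (C(sphere (0 : ℂ) r, ℂ))ˣ,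
      (U : C(sphere (0 : ℂ) r, ℂ)) = u - algebraMap ℂ _ w ∧
      ∀ v, (U⁻¹ : (C(sphere (0 : ℂ) r, ℂ))ˣ).1 v = ((v : ℂ) - w)⁻¹ := by
    intro w hw
    refine ⟨⟨u - algebraMap ℂ _ w, ⟨fun v => ((v : ℂ) - w)⁻¹, ?_⟩, ?_, ?_⟩, rfl, fun v => rfl⟩
    · exact Continuous.inv₀ (by fun_prop) (hne w hw)
    · ext v
      exact mul_inv_cancel₀ (hne w hw v)
    · ext v
      exact inv_mul_cancel₀ (hne w hw v)
  have hk : ∀ w, ‖w‖ < r → ∀ v, k w v = ((v : ℂ) - w)⁻¹ := by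
    intro w hw v
    obtain ⟨U, hU, hU'⟩ := hunit w hw
    rw [← hU' v]
    simp only [k, ← hU, Ring.inverse_unit]
  have hkan : AnalyticAt ℂ k w₀ := by
    obtain ⟨U, hU, -⟩ := hunit w₀ hw₀
    have h3 := analyticAt_inverse (𝕜 := ℂ) U
    rw [hU] at h3
    have h4 : AnalyticAt ℂ (fun w : ℂ => u - algebraMap ℂ C(sphere (0 : ℂ) r, ℂ) w) w₀ :=
      analyticAt_const.sub ((Algebra.linearMap ℂ C(sphere (0 : ℂ) r, ℂ)).toContinuousLinearMap.analyticAt w₀)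
    exact h3.comp_of_eq h4 rfl
  have hfin : AnalyticAt ℂ (fun p : ℂ × ℂ => (2 * Real.pi * Complex.I : ℂ)⁻¹ *
      circleIntegralCLM r hr.le (k p.2 * G p.1)) (z₀, w₀) := by
    refine analyticAt_const.mul ?_
    refine ((circleIntegralCLM r hr.le).analyticAt _).comp ?_
    exact (hkan.comp_of_eq analyticAt_snd rfl).mul (hGan.comp_of_eq analyticAt_fst rfl)
  refine hfin.congr ?_
  have hop : ball (0 : ℂ × ℂ) r ∈ 𝓝 (z₀, w₀) := isOpen_ball.mem_nhds (by simpa using hxr)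
  filter_upwards [hop] with p hp
  obtain ⟨hz, hw⟩ : ‖p.1‖ < r ∧ ‖p.2‖ < r := by
    simpa [Prod.norm_def] using hp
  have hd : DiffContOnCl ℂ (fun w => f (p.1, w)) (ball 0 r) :=
    ((h2 p.1 (hz.trans hrR)).mono hdR).diffContOnCl
  have h5 := hd.two_pi_i_inv_smul_circleIntegral_sub_inv_smul (mem_ball_zero_iff.2 hw)
  rw [circleIntegralCLM_apply hr.le _ (fun v => (v - p.2)⁻¹ • f (p.1, v))]
  · exact h5
  · intro v
    rw [ContinuousMap.mul_apply, hk _ hw, hG _ hz, smul_eq_mul]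

theorem analyticOnNhd_of_tendstoUniformlyOn {F : ℕ → ℂ × ℂ → ℂ × ℂ} {f : ℂ × ℂ → ℂ × ℂ} {R : ℝ}
    (hF : ∀ n, AnalyticOnNhd ℂ (F n) (ball 0 R))
    (h : TendstoUniformlyOn F f atTop (ball 0 R)) : AnalyticOnNhd ℂ f (ball 0 R) := by
  have hcont : ContinuousOn f (ball 0 R) :=
    h.continuousOn (Frequently.of_forall fun n => (hF n).continuousOn)
  have key : ∀ L : ℂ × ℂ →L[ℂ] ℂ, AnalyticOnNhd ℂ (fun x => L (f x)) (ball 0 R) := by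
    intro L
    have hmem : ∀ z w : ℂ, ‖z‖ < R → ‖w‖ < R → (z, w) ∈ ball (0 : ℂ × ℂ) R := by
      intro z w hz hw
      rw [mem_ball_zero_iff, Prod.norm_def]
      exact max_lt hz hw
    have hL : TendstoUniformlyOn (fun n x => L (F n x)) (fun x => L (f x)) atTop (ball 0 R) :=
      L.uniformContinuous.comp_tendstoUniformlyOn h
    have line : ∀ i : ℂ → ℂ × ℂ, Differentiable ℂ i → MapsTo i (ball 0 R) (ball 0 R) →
        DifferentiableOn ℂ (fun z => L (f (i z))) (ball 0 R) := by
      intro i hi hmaps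
      have h1 : TendstoUniformlyOn (fun n z => L (F n (i z))) (fun z => L (f (i z))) atTop
          (ball 0 R) := (hL.comp i).mono hmaps
      refine h1.tendstoLocallyUniformlyOn.differentiableOn (Eventually.of_forall fun n => ?_)
        isOpen_ball
      exact L.differentiable.comp_differentiableOn
        ((hF n).differentiableOn.comp hi.differentiableOn hmaps)
    refine analyticOnNhd_of_separately_differentiable (L.continuous.comp_continuousOn hcont)
      (fun w hw => ?_) (fun z hz => ?_)
    · exact line (fun z => (z, w)) (by fun_prop)
        fun z hz => hmem _ _ (mem_ball_zero_iff.1 hz) hw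
    · exact line (fun w => (z, w)) (by fun_prop)
        fun w hw => hmem _ _ hz (mem_ball_zero_iff.1 hw)
  exact (key (ContinuousLinearMap.fst ℂ ℂ ℂ)).prod (key (ContinuousLinearMap.snd ℂ ℂ ℂ))

/-- `orb F n = F (n - 1) ∘ ⋯ ∘ F 0`. -/
def orb {α : Type*} (F : ℕ → α → α) : ℕ → α → α
  | 0 => id
  | n + 1 => F n ∘ orb F n

/-- `orbInv F n = F 0 ∘ ⋯ ∘ F (n - 1)`. -/
def orbInv {α : Type*} (F : ℕ → α → α) : ℕ → α → α
  | 0 => id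
  | n + 1 => orbInv F n ∘ F n

lemma orbInv_orb {α : Type*} {F Fi : ℕ → α → α} (h : ∀ n, Function.LeftInverse (Fi n) (F n)) :
    ∀ n, Function.LeftInverse (orbInv Fi n) (orb F n)
  | 0 => fun _ => rfl
  | n + 1 => (h n).comp (orbInv_orb h n)

lemma orb_orbInv {α : Type*} {F Fi : ℕ → α → α} (h : ∀ n, Function.RightInverse (Fi n) (F n)) :
    ∀ n, Function.RightInverse (orbInv Fi n) (orb F n)
  | 0 => fun _ => rfl
  | n + 1 => (h n).comp (orb_orbInv h n)

lemma analyticAt_orb {E : Type*} [NormedAddCommGroup E] [NormedSpace ℂ E] {F : ℕ → E → E}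
    (h : ∀ n x, AnalyticAt ℂ (F n) x) (n : ℕ) : ∀ x, AnalyticAt ℂ (orb F n) x := by
  induction n with
  | zero => exact fun x => analyticAt_id
  | succ n ih => exact fun x => (h n _).comp (ih x)

lemma analyticAt_orbInv {E : Type*} [NormedAddCommGroup E] [NormedSpace ℂ E] {F : ℕ → E → E}
    (h : ∀ n x, AnalyticAt ℂ (F n) x) (n : ℕ) : ∀ x, AnalyticAt ℂ (orbInv F n) x := by
  induction n with
  | zero => exact fun x => analyticAt_id
  | succ n ih => exact fun x => (ih _).comp (h n x)

lemma orb_mem_of_le {α : Type*} {F : ℕ → α → α} {s : Set α} (h : ∀ n, MapsTo (F n) s s)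
    {n m : ℕ} (hnm : n ≤ m) {x : α} (hx : orb F n x ∈ s) : orb F m x ∈ s := by
  induction m, hnm using Nat.le_induction with
  | base => exact hx
  | succ m _ ih => exact h m ih

/-- A compatible family of local maps extends to the set of points whose orbit enters the
domain. -/
theorem exists_extension {E : Type*} [NormedAddCommGroup E] [NormedSpace ℂ E]
    {F G Gi Φ : ℕ → E → E} {s : Set E} (hs : IsOpen s)
    (hF : ∀ n x, AnalyticAt ℂ (F n) x) (hGi : ∀ n x, AnalyticAt ℂ (Gi n) x)
    (hG : ∀ n, Function.LeftInverse (Gi n) (G n))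
    (hΦ : ∀ n, AnalyticOnNhd ℂ (Φ n) s) (hmaps : ∀ n, MapsTo (F n) s s)
    (hconj : ∀ n, ∀ x ∈ s, Φ (n + 1) (F n x) = G n (Φ n x)) :
    ∃ Θ : E → E, AnalyticOnNhd ℂ Θ {x | ∃ n, orb F n x ∈ s} ∧
      ∀ n x, orb F n x ∈ s → Θ x = orbInv Gi n (Φ n (orb F n x)) := by
  classical
  have step : ∀ n m x, n ≤ m → orb F n x ∈ s →
      orbInv Gi m (Φ m (orb F m x)) = orbInv Gi n (Φ n (orb F n x)) := by
    intro n m x hnm hx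
    induction m, hnm using Nat.le_induction with
    | base => rfl
    | succ m hm ih =>
      rw [← ih]
      simp only [orb, orbInv, Function.comp_apply]
      rw [hconj m _ (orb_mem_of_le hmaps hm hx), hG m]
  let Θ : E → E := fun x =>
    if h : ∃ n, orb F n x ∈ s then orbInv Gi (Nat.find h) (Φ (Nat.find h) (orb F (Nat.find h) x)) else 0
  have hΘ : ∀ n x, orb F n x ∈ s → Θ x = orbInv Gi n (Φ n (orb F n x)) := by
    intro n x hx
    have h : ∃ n, orb F n x ∈ s := ⟨n, hx⟩
    simp only [Θ, dif_pos h]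
    exact (step _ _ x (Nat.find_min' h hx) (Nat.find_spec h)).symm
  refine ⟨Θ, ?_, hΘ⟩
  rintro x ⟨n, hx⟩
  have h1 : AnalyticAt ℂ (fun x => orbInv Gi n (Φ n (orb F n x))) x :=
    (analyticAt_orbInv hGi n _).comp ((hΦ n _ hx).comp (analyticAt_orb hF n x))
  refine h1.congr ?_
  filter_upwards [(analyticAt_orb hF n x).continuousAt.preimage_mem_nhds (hs.mem_nhds hx)]
    with y hy using (hΘ n y hy).symm

/-- Local conjugacies between two sequences of automorphisms, the second of which has all of
`ℂ²` as its basin, glue to a biholomorphism of the basin of the first onto `ℂ²`. -/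
theorem biholomorphicTo_of_local_conj {F Fi G Gi Φ Ψ : ℕ → ℂ × ℂ → ℂ × ℂ} {s t : Set (ℂ × ℂ)}
    (hs : IsOpen s) (ht : IsOpen t)
    (hF : ∀ n x, AnalyticAt ℂ (F n) x) (hFi : ∀ n x, AnalyticAt ℂ (Fi n) x)
    (hFl : ∀ n, Function.LeftInverse (Fi n) (F n)) (hFr : ∀ n, Function.RightInverse (Fi n) (F n))
    (hG : ∀ n x, AnalyticAt ℂ (G n) x) (hGi : ∀ n x, AnalyticAt ℂ (Gi n) x)
    (hGl : ∀ n, Function.LeftInverse (Gi n) (G n)) (hGr : ∀ n, Function.RightInverse (Gi n) (G n))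
    (hΦ : ∀ n, AnalyticOnNhd ℂ (Φ n) s) (hΨ : ∀ n, AnalyticOnNhd ℂ (Ψ n) t)
    (hΦinj : ∀ n, InjOn (Φ n) s) (hΨmaps : ∀ n, MapsTo (Ψ n) t s)
    (hΦΨ : ∀ n, ∀ y ∈ t, Φ n (Ψ n y) = y)
    (hFs : ∀ n, MapsTo (F n) s s) (hGt : ∀ n, MapsTo (G n) t t)
    (hconj : ∀ n, ∀ x ∈ s, Φ (n + 1) (F n x) = G n (Φ n x))
    (habs : ∀ y, ∃ n, orb G n y ∈ t) :
    BiholomorphicTo {x | ∃ n, orb F n x ∈ s} Set.univ := by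
  have hconj' : ∀ n, ∀ y ∈ t, Ψ (n + 1) (G n y) = F n (Ψ n y) := by
    intro n y hy
    apply hΦinj (n + 1) (hΨmaps _ (hGt n hy)) (hFs n (hΨmaps n hy))
    rw [hΦΨ _ _ (hGt n hy), hconj n _ (hΨmaps n hy), hΦΨ n y hy]
  obtain ⟨P, hPan, hP⟩ := exists_extension hs hF hGi hGl hΦ hFs hconj
  obtain ⟨Q, hQan, hQ⟩ := exists_extension ht hG hFi hFl hΨ hGt hconj'
  have hQorb : ∀ n y, orb G n y ∈ t → orb F n (Q y) = Ψ n (orb G n y) := by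
    intro n y hy
    rw [hQ n y hy, orb_orbInv hFr n]
  refine ⟨P, Q, hPan.analyticOn, ?_, fun _ _ => mem_univ _, ?_, ?_, ?_⟩
  · exact (hQan.mono fun y _ => habs y).analyticOn
  · intro y _
    obtain ⟨n, hn⟩ := habs y
    exact ⟨n, by rw [hQorb n y hn]; exact hΨmaps n hn⟩
  · rintro x ⟨n, hn⟩
    obtain ⟨m, hm⟩ := habs (P x)
    have hx := orb_mem_of_le hFs (le_max_left n m) hn
    have hy := orb_mem_of_le hGt (le_max_right n m) hm
    rw [hQ _ _ hy]
    have h1 : orb G (max n m) (P x) = Φ (max n m) (orb F (max n m) x) := by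
      rw [hP _ _ hx, orb_orbInv hGr]
    have h2 : Ψ (max n m) (orb G (max n m) (P x)) = orb F (max n m) x := by
      apply hΦinj _ (hΨmaps _ hy) hx
      rw [hΦΨ _ _ hy, h1]
    rw [h2, orbInv_orb hFl]
  · intro y _
    obtain ⟨n, hn⟩ := habs y
    have h1 := hQorb n y hn
    rw [hP n (Q y) (by rw [h1]; exact hΨmaps n hn), h1, hΦΨ n _ hn, orbInv_orb hGl]

/-- A holomorphic map that is tangent to the identity is invertible on a ball whose radius depends
only on the bound for its nonlinear part. -/
theorem exists_local_inverse {E : Type*} [NormedAddCommGroup E] [NormedSpace ℂ E] [CompleteSpace E]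
    [Nontrivial E] {Φ : E → E} {r M ρ : ℝ} (hΦ : AnalyticOnNhd ℂ Φ (ball 0 r))
    (hM0 : 0 ≤ M) (hM : ∀ x ∈ ball (0 : E) r, ‖Φ x - x‖ ≤ M * ‖x‖ ^ 2)
    (hρ : 0 < ρ) (hρr : 2 * ρ ≤ r) (hMρ : 16 * M * ρ ≤ 1) :
    InjOn Φ (ball 0 ρ) ∧ ∃ Ψ : E → E, AnalyticOnNhd ℂ Ψ (ball 0 (ρ / 4)) ∧
      MapsTo Ψ (ball 0 (ρ / 4)) (ball 0 ρ) ∧ ∀ y ∈ ball (0 : E) (ρ / 4), Φ (Ψ y) = y := by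
  have hsub : ball (0 : E) ρ ⊆ ball 0 r := ball_subset_ball (by linarith)
  set u : E → E := fun x => Φ x - x with hu
  have hua : AnalyticOnNhd ℂ u (ball 0 r) := hΦ.sub analyticOnNhd_id
  have hder : ∀ x ∈ ball (0 : E) ρ, ‖fderiv ℂ u x‖ ≤ 1 / 2 := by
    intro x hx
    have hx' := mem_ball_zero_iff.1 hx
    have hball : ∀ y ∈ ball x ρ, ‖y‖ < 2 * ρ := by
      intro y hy
      have h1 : ‖y - x‖ < ρ := by simpa [dist_eq_norm] using hy
      have h2 : ‖y‖ ≤ ‖y - x‖ + ‖x‖ := by simpa using norm_add_le (y - x) x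
      linarith
    have hbound : ∀ y, ‖y‖ < 2 * ρ → ‖u y‖ ≤ 4 * M * ρ ^ 2 := by
      intro y hy
      refine (hM y (mem_ball_zero_iff.2 (by linarith))).trans ?_
      have : ‖y‖ ^ 2 ≤ (2 * ρ) ^ 2 := by gcongr
      nlinarith
    have h := Complex.norm_fderiv_le_div_of_mapsTo_ball (f := u) (c := x) (R₁ := ρ)
      (R₂ := 8 * M * ρ ^ 2)
      (fun y hy => (hua y (mem_ball_zero_iff.2 ((hball y hy).trans_le hρr))).differentiableAt.differentiableWithinAt)
      (by
        intro y hy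
        rw [mem_closedBall, dist_eq_norm]
        have h1 := hbound y (hball y hy)
        have h2 := hbound x (by linarith)
        linarith [norm_sub_le (u y) (u x)]) hρ
    refine h.trans ?_
    rw [div_le_iff₀ hρ]
    nlinarith
  have happ : ApproximatesLinearOn Φ ((ContinuousLinearEquiv.refl ℂ E : E ≃L[ℂ] E) : E →L[ℂ] E)
      (ball 0 ρ) (1 / 2) := by
    let _ : NormedSpace ℝ E := NormedSpace.restrictScalars ℝ ℂ E
    intro x hx y hy
    have h := Convex.norm_image_sub_le_of_norm_fderiv_le (𝕜 := ℂ) (f := u) (C := 1 / 2)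
      (fun z hz => (hua z (hsub hz)).differentiableAt) hder (convex_ball 0 ρ) hy hx
    have he : Φ x - Φ y - (ContinuousLinearEquiv.refl ℂ E : E →L[ℂ] E) (x - y) = u x - u y := by
      simp only [hu, ContinuousLinearEquiv.coe_refl, ContinuousLinearMap.id_apply]
      abel
    rw [he]
    simpa using h
  have hc : Subsingleton E ∨
      (1 / 2 : NNReal) < ‖((ContinuousLinearEquiv.refl ℂ E).symm : E →L[ℂ] E)‖₊⁻¹ := by
    right
    have : ‖((ContinuousLinearEquiv.refl ℂ E).symm : E →L[ℂ] E)‖₊ = 1 := by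
      ext
      simp
    rw [this]
    norm_num
  refine ⟨happ.injOn hc, ?_⟩
  have hΦ0 : Φ 0 = 0 := by
    have := hM 0 (mem_ball_self (by linarith))
    simpa using this
  set e := happ.toOpenPartialHomeomorph Φ (ball 0 ρ) hc isOpen_ball with he
  have hcoe : (e : E → E) = Φ := rfl
  have hsrc : e.source = ball 0 ρ := rfl
  have htgt : ball (0 : E) (ρ / 4) ⊆ e.target := by
    have h := happ.closedBall_subset_target hc isOpen_ball (b := 0) (ε := ρ / 2) (by linarith)
      (closedBall_subset_ball (by linarith))
    refine Subset.trans ?_ h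
    rw [hΦ0]
    refine ball_subset_closedBall.trans (closedBall_subset_closedBall ?_)
    have : ‖((ContinuousLinearEquiv.refl ℂ E).symm : E →L[ℂ] E)‖₊ = 1 := by
      ext
      simp
    rw [this]
    norm_num
    linarith
  refine ⟨e.symm, ?_, ?_, ?_⟩
  · intro y hy
    have hx : e.symm y ∈ ball (0 : E) ρ := e.map_target (htgt hy)
    have hlt : ‖-fderiv ℂ u (e.symm y)‖ < 1 := by
      rw [norm_neg]
      linarith [hder _ hx]
    have hfd : fderiv ℂ e (e.symm y) = (ContinuousLinearEquiv.unitsEquiv ℂ E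
        (Units.oneSub (-fderiv ℂ u (e.symm y)) hlt) : E →L[ℂ] E) := by
      have h1 : fderiv ℂ u (e.symm y) = fderiv ℂ Φ (e.symm y) - ContinuousLinearMap.id ℂ E := by
        exact ((hΦ _ (hsub hx)).differentiableAt.hasFDerivAt.sub (hasFDerivAt_id _)).fderiv
      ext v
      simp [hcoe, h1]
    have := e.analyticAt_symm' (a := e.symm y) hx (hΦ _ (hsub hx)) hfd
    rwa [e.right_inv (htgt hy)] at this
  · intro y hy
    exact e.map_target (htgt hy)
  · intro y hy
    exact e.right_inv (htgt hy)

/-- Two sequences of contractions that are approximately conjugate to sufficiently high order are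
conjugate near the origin. -/
theorem exists_local_conj {F h G Gi : ℕ → ℂ × ℂ → ℂ × ℂ} {δ κ K A : ℝ} {k : ℕ} (hk : 1 ≤ k)
    (hδ0 : 0 ≤ δ) (hδ : δ < 1) (hA : 0 ≤ A) (hAδ : A * δ ^ (k + 1) < 1) (hκ : 0 ≤ κ) (hK : 0 ≤ K)
    (hFa : ∀ n x, AnalyticAt ℂ (F n) x) (hha : ∀ n x, AnalyticAt ℂ (h n) x)
    (hGa : ∀ n x, AnalyticAt ℂ (Gi n) x)
    (hGl : ∀ n, Function.LeftInverse (Gi n) (G n)) (hGr : ∀ n, Function.RightInverse (Gi n) (G n))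
    (hF : ∀ n x, ‖x‖ ≤ 1 → ‖F n x‖ ≤ δ * ‖x‖)
    (hh : ∀ n x, ‖x‖ ≤ 1 → ‖h n x - x‖ ≤ κ * ‖x‖ ^ 2)
    (hc : ∀ n x, ‖x‖ ≤ 1 → ‖G n (h n x) - h (n + 1) (F n x)‖ ≤ K * ‖x‖ ^ (k + 1))
    (hGi : ∀ n x y, ‖x‖ ≤ 1 → ‖y‖ ≤ 1 → ‖Gi n x - Gi n y‖ ≤ A * ‖x - y‖) :
    ∃ r > 0, ∃ M ≥ 0, ∃ Φ : ℕ → ℂ × ℂ → ℂ × ℂ, r ≤ 1 ∧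
      (∀ n, AnalyticOnNhd ℂ (Φ n) (ball 0 r)) ∧
      (∀ n, ∀ x ∈ ball (0 : ℂ × ℂ) r, ‖Φ n x - x‖ ≤ M * ‖x‖ ^ 2) ∧
      ∀ n, ∀ x ∈ ball (0 : ℂ × ℂ) r, Φ (n + 1) (F n x) = G n (Φ n x) := by
  set q := A * δ ^ (k + 1) with hq
  have hq0 : 0 ≤ q := by positivity
  have hq1 : 0 < 1 - q := by linarith
  set B := A * K / (1 - q) with hB
  have hB0 : 0 ≤ B := by positivity
  have hBq : A * K + q * B = B := by rw [hB]; field_simp; ring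
  set r := 1 / (1 + κ + B + K) with hr
  have hr0 : 0 < r := by positivity
  have hden : 0 < 1 + κ + B + K := by positivity
  have hr1 : r * (1 + κ + B + K) = 1 := by rw [hr]; field_simp
  have hrle : r ≤ 1 := by nlinarith
  have hFb : ∀ n, MapsTo (F n) (ball 0 r) (ball 0 r) := by
    intro n x hx
    rw [mem_ball_zero_iff] at *
    nlinarith [hF n x (by linarith), norm_nonneg x]
  have hpow : ∀ n x, ‖x‖ ≤ 1 → ‖F n x‖ ^ (k + 1) ≤ δ ^ (k + 1) * ‖x‖ ^ (k + 1) := by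
    intro n x hx
    rw [← mul_pow]
    exact pow_le_pow_left₀ (norm_nonneg _) (hF n x hx) _
  have hp2 : ∀ x : ℂ × ℂ, ‖x‖ ≤ 1 → ‖x‖ ^ (k + 1) ≤ ‖x‖ ^ 2 := fun x hx =>
    pow_le_pow_of_le_one (norm_nonneg _) hx (by omega)
  have hp1 : ∀ x : ℂ × ℂ, ‖x‖ ≤ 1 → ‖x‖ ^ 2 ≤ ‖x‖ := fun x hx => by
    nlinarith [norm_nonneg x]
  let Θ : ℕ → ℕ → ℂ × ℂ → ℂ × ℂ := fun j =>
    Nat.rec h (fun _ T n x => Gi n (T (n + 1) (F n x))) j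
  have Θ0 : Θ 0 = h := rfl
  have Θs : ∀ j n x, Θ (j + 1) n x = Gi n (Θ j (n + 1) (F n x)) := fun _ _ _ => rfl
  have hΘa : ∀ j n x, AnalyticAt ℂ (Θ j n) x := by
    intro j
    induction j with
    | zero => exact hha
    | succ j ih => exact fun n x => (hGa n _).comp ((ih (n + 1) _).comp (hFa n x))
  have bound : ∀ j, (∀ n x, ‖x‖ < r → ‖Θ j n x - h n x‖ ≤ B * ‖x‖ ^ (k + 1)) := by
    intro j
    induction j with
    | zero => intro n x _; simp only [Θ0, sub_self, norm_zero]; positivity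
    | succ j ih =>
      intro n x hx
      have hx1 : ‖x‖ ≤ 1 := by linarith
      have hFx := hFb n (mem_ball_zero_iff.2 hx)
      rw [mem_ball_zero_iff] at hFx
      have hFx1 : ‖F n x‖ ≤ 1 := by linarith
      have h1 := ih (n + 1) _ hFx
      have h2 := hh (n + 1) _ hFx1
      have h3 := hc n x hx1
      have hFle : ‖F n x‖ ≤ ‖x‖ := by nlinarith [hF n x hx1, norm_nonneg x]
      have hhn : ‖h (n + 1) (F n x)‖ ≤ ‖F n x‖ + κ * ‖F n x‖ := by
        have : ‖h (n + 1) (F n x)‖ ≤ ‖F n x‖ + ‖h (n + 1) (F n x) - F n x‖ := by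
          simpa using norm_add_le (F n x) (h (n + 1) (F n x) - F n x)
        nlinarith [hp1 _ hFx1]
      have hu : ‖Θ j (n + 1) (F n x)‖ ≤ 1 := by
        have : ‖Θ j (n + 1) (F n x)‖ ≤ ‖h (n + 1) (F n x)‖ +
            ‖Θ j (n + 1) (F n x) - h (n + 1) (F n x)‖ := by
          simpa using norm_add_le (h (n + 1) (F n x)) (Θ j (n + 1) (F n x) - h (n + 1) (F n x))
        have h4 : B * ‖F n x‖ ^ (k + 1) ≤ B * ‖F n x‖ := by
          gcongr; exact (hp2 _ hFx1).trans (hp1 _ hFx1)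
        nlinarith
      have hv : ‖G n (h n x)‖ ≤ 1 := by
        have : ‖G n (h n x)‖ ≤ ‖h (n + 1) (F n x)‖ + ‖G n (h n x) - h (n + 1) (F n x)‖ := by
          simpa using norm_add_le (h (n + 1) (F n x)) (G n (h n x) - h (n + 1) (F n x))
        have h4 : K * ‖x‖ ^ (k + 1) ≤ K * ‖x‖ := by
          gcongr; exact (hp2 _ hx1).trans (hp1 _ hx1)
        nlinarith
      have h5 := hGi n _ _ hu hv
      rw [hGl n] at h5
      rw [Θs]
      refine h5.trans ?_
      have h6 : ‖Θ j (n + 1) (F n x) - G n (h n x)‖ ≤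
          ‖Θ j (n + 1) (F n x) - h (n + 1) (F n x)‖ + ‖G n (h n x) - h (n + 1) (F n x)‖ := by
        rw [← norm_neg (G n (h n x) - h (n + 1) (F n x))]
        simpa using norm_add_le (Θ j (n + 1) (F n x) - h (n + 1) (F n x))
          (-(G n (h n x) - h (n + 1) (F n x)))
      have h7 : B * ‖F n x‖ ^ (k + 1) ≤ B * (δ ^ (k + 1) * ‖x‖ ^ (k + 1)) := by
        gcongr; exact hpow n x hx1
      calc A * ‖Θ j (n + 1) (F n x) - G n (h n x)‖
          ≤ A * (B * (δ ^ (k + 1) * ‖x‖ ^ (k + 1)) + K * ‖x‖ ^ (k + 1)) := by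
            gcongr; linarith
        _ = (A * K + q * B) * ‖x‖ ^ (k + 1) := by rw [hq]; ring
        _ = B * ‖x‖ ^ (k + 1) := by rw [hBq]
  have size : ∀ j n x, ‖x‖ < r → ‖Θ j n x - x‖ ≤ (κ + B) * ‖x‖ ^ 2 := by
    intro j n x hx
    have hx1 : ‖x‖ ≤ 1 := by linarith
    have h1 := bound j n x hx
    have h2 := hh n x hx1
    have h3 : ‖Θ j n x - x‖ ≤ ‖Θ j n x - h n x‖ + ‖h n x - x‖ := by
      simpa using norm_add_le (Θ j n x - h n x) (h n x - x)
    have h4 := mul_le_mul_of_nonneg_left (hp2 x hx1) hB0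
    linarith
  have small : ∀ j n x, ‖x‖ < r → ‖Θ j n x‖ ≤ 1 := by
    intro j n x hx
    have hx1 : ‖x‖ ≤ 1 := by linarith
    have h1 := size j n x hx
    have h2 : ‖Θ j n x‖ ≤ ‖x‖ + ‖Θ j n x - x‖ := by
      simpa using norm_add_le x (Θ j n x - x)
    have h3 : (κ + B) * ‖x‖ ^ 2 ≤ (κ + B) * ‖x‖ := by gcongr; exact hp1 x hx1
    nlinarith [norm_nonneg x]
  have diff : ∀ j n x, ‖x‖ < r → ‖Θ j n x - Θ (j + 1) n x‖ ≤ B * q ^ j * ‖x‖ ^ (k + 1) := by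
    intro j
    induction j with
    | zero =>
      intro n x hx
      rw [norm_sub_rev]
      simpa [Θ0] using bound 1 n x hx
    | succ j ih =>
      intro n x hx
      have hx1 : ‖x‖ ≤ 1 := by linarith
      have hFx := hFb n (mem_ball_zero_iff.2 hx)
      rw [mem_ball_zero_iff] at hFx
      rw [Θs, Θs (j + 1)]
      refine (hGi n _ _ (small j (n + 1) _ hFx) (small (j + 1) (n + 1) _ hFx)).trans ?_
      calc A * ‖Θ j (n + 1) (F n x) - Θ (j + 1) (n + 1) (F n x)‖
          ≤ A * (B * q ^ j * (δ ^ (k + 1) * ‖x‖ ^ (k + 1))) := by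
            gcongr
            refine (ih (n + 1) _ hFx).trans ?_
            gcongr
            exact hpow n x hx1
        _ = B * q ^ (j + 1) * ‖x‖ ^ (k + 1) := by rw [hq]; ring
  have diff' : ∀ n x, ‖x‖ < r → ∀ j, dist (Θ j n x) (Θ (j + 1) n x) ≤ B * q ^ j := by
    intro n x hx j
    rw [dist_eq_norm]
    refine (diff j n x hx).trans (mul_le_of_le_one_right (by positivity) ?_)
    exact pow_le_one₀ (norm_nonneg _) (by linarith)
  have hex : ∀ n x, ∃ y, ‖x‖ < r → Tendsto (fun j => Θ j n x) atTop (𝓝 y) := by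
    intro n x
    by_cases hx : ‖x‖ < r
    · obtain ⟨y, hy⟩ := cauchySeq_tendsto_of_complete
        (cauchySeq_of_le_geometric q B hAδ (diff' n x hx))
      exact ⟨y, fun _ => hy⟩
    · exact ⟨0, fun h => absurd h hx⟩
  choose Φ hΦ using hex
  refine ⟨r, hr0, κ + B, by positivity, Φ, hrle, ?_, ?_, ?_⟩
  · intro n
    refine analyticOnNhd_of_tendstoUniformlyOn (F := fun j => Θ j n) (fun j x _ => hΘa j n x) ?_
    rw [Metric.tendstoUniformlyOn_iff]
    intro ε hε
    have hlim : Tendsto (fun j => B * q ^ j / (1 - q)) atTop (𝓝 0) := by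
      simpa using ((tendsto_pow_atTop_nhds_zero_of_lt_one hq0 hAδ).const_mul B).div_const (1 - q)
    filter_upwards [hlim.eventually_lt_const hε] with j hj x hx
    rw [mem_ball_zero_iff] at hx
    rw [dist_comm]
    exact (dist_le_of_le_geometric_of_tendsto q B hAδ (diff' n x hx) (hΦ n x hx) j).trans_lt hj
  · intro n x hx
    rw [mem_ball_zero_iff] at hx
    exact le_of_tendsto ((hΦ n x hx).sub_const x).norm (Eventually.of_forall fun j => size j n x hx)
  · intro n x hx
    have hFx := mem_ball_zero_iff.1 (hFb n hx)
    rw [mem_ball_zero_iff] at hx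
    have h1 : Tendsto (fun j => Θ (j + 1) n x) atTop (𝓝 (Φ n x)) :=
      (hΦ n x hx).comp (tendsto_add_atTop_nat 1)
    have h2 : Tendsto (fun j => Θ (j + 1) n x) atTop (𝓝 (Gi n (Φ (n + 1) (F n x)))) :=
      ((hGa n _).continuousAt.tendsto).comp (hΦ (n + 1) _ hFx)
    rw [tendsto_nhds_unique h1 h2, hGr n]

/-- The binary form of degree `k` with coefficients `c`. -/
def homPoly (k : ℕ) (c : ℕ → ℂ) (x : ℂ × ℂ) : ℂ :=
  ∑ i ∈ Finset.range (k + 1), c i * (x.1 ^ i * x.2 ^ (k - i))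

lemma norm_monomial_le {x : ℂ × ℂ} (i j : ℕ) : ‖x.1 ^ i * x.2 ^ j‖ ≤ ‖x‖ ^ (i + j) := by
  rw [norm_mul, norm_pow, norm_pow, pow_add]
  gcongr
  · exact norm_fst_le x
  · exact norm_snd_le x

lemma norm_monomial_sub_mul_le {x y : ℂ × ℂ} {R : ℝ} (hx : ‖x‖ ≤ R) (hy : ‖y‖ ≤ R) (i j : ℕ) :
    ‖x.1 ^ i * x.2 ^ j - y.1 ^ i * y.2 ^ j‖ * R ≤ (i + j) * R ^ (i + j) * ‖x - y‖ := by
  have hR : 0 ≤ R := (norm_nonneg x).trans hx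
  have hy' : ∀ i j : ℕ, ‖y.1 ^ i * y.2 ^ j‖ ≤ R ^ (i + j) := fun i j =>
    (norm_monomial_le i j).trans (pow_le_pow_left₀ (norm_nonneg _) hy _)
  have h1 : ‖x.1 - y.1‖ ≤ ‖x - y‖ := norm_fst_le (x - y)
  have h2 : ‖x.2 - y.2‖ ≤ ‖x - y‖ := norm_snd_le (x - y)
  have hx1 : ‖x.1‖ ≤ R := (norm_fst_le x).trans hx
  have hx2 : ‖x.2‖ ≤ R := (norm_snd_le x).trans hx
  induction i with
  | zero =>
    induction j with
    | zero => simp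
    | succ j ih =>
      have e : x.1 ^ 0 * x.2 ^ (j + 1) - y.1 ^ 0 * y.2 ^ (j + 1) =
          x.2 * (x.1 ^ 0 * x.2 ^ j - y.1 ^ 0 * y.2 ^ j) + (x.2 - y.2) * (y.1 ^ 0 * y.2 ^ j) := by
        ring
      rw [e]
      calc _ ≤ (‖x.2‖ * ‖x.1 ^ 0 * x.2 ^ j - y.1 ^ 0 * y.2 ^ j‖ +
            ‖x.2 - y.2‖ * ‖y.1 ^ 0 * y.2 ^ j‖) * R := by
            gcongr
            exact (norm_add_le _ _).trans (by rw [norm_mul, norm_mul])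
        _ ≤ (R * ‖x.1 ^ 0 * x.2 ^ j - y.1 ^ 0 * y.2 ^ j‖ + ‖x - y‖ * R ^ (0 + j)) * R := by
            gcongr
            exact hy' 0 j
        _ = R * (‖x.1 ^ 0 * x.2 ^ j - y.1 ^ 0 * y.2 ^ j‖ * R) + ‖x - y‖ * R ^ (0 + j) * R := by
            ring
        _ ≤ R * (((0 : ℕ) + j) * R ^ (0 + j) * ‖x - y‖) + ‖x - y‖ * R ^ (0 + j) * R := by
            gcongr
        _ = _ := by push_cast; ring
  | succ i ih =>
    have e : x.1 ^ (i + 1) * x.2 ^ j - y.1 ^ (i + 1) * y.2 ^ j =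
        x.1 * (x.1 ^ i * x.2 ^ j - y.1 ^ i * y.2 ^ j) + (x.1 - y.1) * (y.1 ^ i * y.2 ^ j) := by
      ring
    rw [e]
    calc _ ≤ (‖x.1‖ * ‖x.1 ^ i * x.2 ^ j - y.1 ^ i * y.2 ^ j‖ +
          ‖x.1 - y.1‖ * ‖y.1 ^ i * y.2 ^ j‖) * R := by
          gcongr
          exact (norm_add_le _ _).trans (by rw [norm_mul, norm_mul])
      _ ≤ (R * ‖x.1 ^ i * x.2 ^ j - y.1 ^ i * y.2 ^ j‖ + ‖x - y‖ * R ^ (i + j)) * R := by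
          gcongr
          exact hy' i j
      _ = R * (‖x.1 ^ i * x.2 ^ j - y.1 ^ i * y.2 ^ j‖ * R) + ‖x - y‖ * R ^ (i + j) * R := by
          ring
      _ ≤ R * ((i + j) * R ^ (i + j) * ‖x - y‖) + ‖x - y‖ * R ^ (i + j) * R := by
          gcongr
      _ = _ := by push_cast; ring

lemma norm_monomial_sub_le {x y : ℂ × ℂ} {R : ℝ} (hx : ‖x‖ ≤ R) (hy : ‖y‖ ≤ R) {i j k : ℕ}
    (hk : i + j = k) :
    ‖x.1 ^ i * x.2 ^ j - y.1 ^ i * y.2 ^ j‖ ≤ k * R ^ (k - 1) * ‖x - y‖ := by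
  rcases ((norm_nonneg x).trans hx).eq_or_lt with hR | hR
  · have hx0 : x = 0 := norm_le_zero_iff.1 (by linarith)
    have hy0 : y = 0 := norm_le_zero_iff.1 (by linarith)
    simp [hx0, hy0]
  · have h := norm_monomial_sub_mul_le hx hy i j
    rw [hk] at h
    rcases Nat.eq_zero_or_pos k with h0 | h0
    · obtain ⟨rfl, rfl⟩ : i = 0 ∧ j = 0 := by omega
      simp [h0]
    · rw [← mul_le_mul_iff_left₀ hR]
      refine h.trans (le_of_eq ?_)
      rw [← hk, ← Nat.cast_add, hk]
      conv_lhs => rw [show k = (k - 1) + 1 by omega, pow_succ]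
      rw [show k - 1 + 1 = k by omega]
      ring

lemma norm_homPoly_le {k : ℕ} {c : ℕ → ℂ} {K : ℝ} (hc : ∀ i ≤ k, ‖c i‖ ≤ K) (x : ℂ × ℂ) :
    ‖homPoly k c x‖ ≤ (k + 1) * K * ‖x‖ ^ k := by
  have : ∀ i ∈ Finset.range (k + 1), ‖c i * (x.1 ^ i * x.2 ^ (k - i))‖ ≤ K * ‖x‖ ^ k := by
    intro i hi
    have hi' : i ≤ k := by simpa [Nat.lt_succ_iff] using hi
    rw [norm_mul]
    have h := norm_monomial_le (x := x) i (k - i)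
    rw [show i + (k - i) = k by omega] at h
    exact mul_le_mul (hc i hi') h (norm_nonneg _) ((norm_nonneg _).trans (hc i hi'))
  refine (norm_sum_le_of_le _ this).trans (le_of_eq ?_)
  simp
  ring

lemma norm_homPoly_sub_le {k : ℕ} {c : ℕ → ℂ} {K R : ℝ} (hc : ∀ i ≤ k, ‖c i‖ ≤ K) {x y : ℂ × ℂ}
    (hx : ‖x‖ ≤ R) (hy : ‖y‖ ≤ R) :
    ‖homPoly k c x - homPoly k c y‖ ≤ (k + 1) * K * (k * R ^ (k - 1) * ‖x - y‖) := by
  have : ∀ i ∈ Finset.range (k + 1),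
      ‖c i * (x.1 ^ i * x.2 ^ (k - i)) - c i * (y.1 ^ i * y.2 ^ (k - i))‖ ≤
        K * (k * R ^ (k - 1) * ‖x - y‖) := by
    intro i hi
    have hi' : i ≤ k := by simpa [Nat.lt_succ_iff] using hi
    rw [← mul_sub, norm_mul]
    exact mul_le_mul (hc i hi') (norm_monomial_sub_le hx hy (by omega)) (norm_nonneg _)
      ((norm_nonneg _).trans (hc i hi'))
  unfold homPoly
  rw [← Finset.sum_sub_distrib]
  refine (norm_sum_le_of_le _ this).trans (le_of_eq ?_)
  simp
  ring

lemma homPoly_diag (k : ℕ) (c : ℕ → ℂ) (a b : ℂ) (x : ℂ × ℂ) :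
    homPoly k c (a * x.1, b * x.2) = homPoly k (fun i => a ^ i * b ^ (k - i) * c i) x := by
  unfold homPoly
  refine Finset.sum_congr rfl fun i _ => ?_
  ring

lemma analyticAt_homPoly (k : ℕ) (c : ℕ → ℂ) (x : ℂ × ℂ) : AnalyticAt ℂ (homPoly k c) x := by
  exact Finset.analyticAt_fun_sum _ fun i _ => analyticAt_const.mul
    ((analyticAt_fst.pow i).mul (analyticAt_snd.pow (k - i)))

/-- A contracting scalar cohomological equation has a bounded solution. -/
lemma exists_bounded_solution {θ p : ℕ → ℂ} {ρ K : ℝ} (hρ : ρ < 1) (hθ : ∀ n, ‖θ n‖ ≤ ρ)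
    (hp : ∀ n, ‖p n‖ ≤ K) :
    ∃ c : ℕ → ℂ, (∀ n, c n = θ n * c (n + 1) + p n) ∧ ∀ n, ‖c n‖ ≤ K / (1 - ρ) := by
  have hρ0 : 0 ≤ ρ := (norm_nonneg _).trans (hθ 0)
  have hb : ∀ n j, ‖(∏ i ∈ Finset.range j, θ (n + i)) * p (n + j)‖ ≤ ρ ^ j * K := by
    intro n j
    rw [norm_mul, norm_prod]
    refine mul_le_mul ?_ (hp _) (norm_nonneg _) (by positivity)
    calc ∏ i ∈ Finset.range j, ‖θ (n + i)‖ ≤ ∏ _i ∈ Finset.range j, ρ :=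
          Finset.prod_le_prod (fun _ _ => norm_nonneg _) fun i _ => hθ _
      _ = ρ ^ j := by simp
  have hg : HasSum (fun j => ρ ^ j * K) ((1 - ρ)⁻¹ * K) :=
    (hasSum_geometric_of_lt_one hρ0 hρ).mul_right K
  have hs : ∀ n, Summable fun j => (∏ i ∈ Finset.range j, θ (n + i)) * p (n + j) := fun n =>
    Summable.of_norm_bounded hg.summable (hb n)
  refine ⟨fun n => ∑' j, (∏ i ∈ Finset.range j, θ (n + i)) * p (n + j), fun n => ?_, fun n => ?_⟩
  · beta_reduce
    rw [(hs n).tsum_eq_zero_add, ← tsum_mul_left]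
    simp only [Finset.range_zero, Finset.prod_empty, one_mul, add_zero]
    rw [add_comm]
    congr 1
    refine tsum_congr fun j => ?_
    rw [Finset.prod_range_succ', add_zero, show n + (j + 1) = n + 1 + j by ring]
    rw [Finset.prod_congr rfl fun i _ => by rw [show n + (i + 1) = n + 1 + i by ring]]
    ring
  · refine (tsum_of_norm_bounded hg (hb n)).trans (le_of_eq ?_)
    rw [div_eq_inv_mul]

/-- Degree `k` terms can be removed at the steps where the multiplier is contracting; the steps in
`S`, at which it need not be, keep a term `e`. -/
lemma exists_coeff {a m p : ℕ → ℂ} {C ρ K : ℝ} (S : Set ℕ) (hC : 0 < C) (hρ0 : 0 ≤ ρ) (hρ : ρ < 1)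
    (ha : ∀ n, C ≤ ‖a n‖) (hm : ∀ n, ‖m n‖ ≤ 1) (hS : ∀ n, n ∉ S → ‖m n‖ ≤ ρ * ‖a n‖)
    (hp : ∀ n, ‖p n‖ ≤ K) :
    ∃ c e : ℕ → ℂ, (∀ n, a n * c n + e n = p n + m n * c (n + 1)) ∧ (∀ n, n ∉ S → e n = 0) ∧
      (∀ n, ‖c n‖ ≤ K * (1 + 1 / (C * (1 - ρ)))) ∧ ∀ n, ‖e n‖ ≤ K * (1 + 1 / (C * (1 - ρ))) := by
  classical
  have hK : 0 ≤ K := (norm_nonneg _).trans (hp 0)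
  have hρ1 : 0 < 1 - ρ := by linarith
  have ha0 : ∀ n, 0 < ‖a n‖ := fun n => hC.trans_le (ha n)
  obtain ⟨c, hc, hcb⟩ := exists_bounded_solution (θ := fun n => if n ∈ S then 0 else m n / a n)
    (p := fun n => if n ∈ S then 0 else p n / a n) (ρ := ρ) (K := K / C) hρ
    (fun n => by
      by_cases h : n ∈ S
      · simpa [h] using hρ0
      · simp only [h, if_false, norm_div]
        rw [div_le_iff₀ (ha0 n)]
        exact hS n h)
    (fun n => by
      by_cases h : n ∈ S
      · simp only [h, if_true, norm_zero]; positivity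
      · simp only [h, if_false, norm_div]
        exact div_le_div₀ hK (hp n) hC (ha n))
  have hcb' : ∀ n, ‖c n‖ ≤ K * (1 / (C * (1 - ρ))) := fun n => (hcb n).trans (le_of_eq (by
    field_simp))
  refine ⟨c, fun n => if n ∈ S then p n + m n * c (n + 1) else 0, ?_, ?_, ?_, ?_⟩
  · intro n
    have hn := hc n
    have ha' : a n ≠ 0 := norm_pos_iff.1 (ha0 n)
    by_cases h : n ∈ S
    · simp only [h, if_true, zero_mul, zero_add] at hn ⊢
      rw [hn]; ring
    · simp only [h, if_false] at hn ⊢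
      rw [hn]; field_simp; ring
  · intro n h
    simp [h]
  · intro n
    refine (hcb' n).trans ?_
    gcongr
    linarith
  · intro n
    by_cases h : n ∈ S
    · simp only [h, if_true]
      have h1 : ‖m n * c (n + 1)‖ ≤ 1 * (K * (1 / (C * (1 - ρ)))) := by
        rw [norm_mul]
        exact mul_le_mul (hm n) (hcb' _) (norm_nonneg _) zero_le_one
      linarith [norm_add_le (p n) (m n * c (n + 1)), hp n]
    · simp only [h, if_false, norm_zero]; positivity

lemma homPoly_eq_single {k j : ℕ} {c : ℕ → ℂ} (hj : j ≤ k) (hc : ∀ i, i ≠ j → c i = 0)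
    (x : ℂ × ℂ) : homPoly k c x = c j * (x.1 ^ j * x.2 ^ (k - j)) := by
  unfold homPoly
  refine Finset.sum_eq_single j (fun i _ hi => ?_) fun h => ?_
  · rw [hc i hi, zero_mul]
  · exact absurd (Finset.mem_range.2 (Nat.lt_succ_of_le hj)) h

/-- The polynomial map `(z, w) ↦ (a z + e w ^ k, b w + e' z ^ k)`. -/
def triMap (k : ℕ) (a b e e' : ℂ) (x : ℂ × ℂ) : ℂ × ℂ :=
  (a * x.1 + e * x.2 ^ k, b * x.2 + e' * x.1 ^ k)

/-- The inverse of `triMap` when `e` or `e'` vanishes. -/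
def triInv (k : ℕ) (a b e e' : ℂ) (y : ℂ × ℂ) : ℂ × ℂ :=
  ((y.1 - e * (y.2 / b) ^ k) / a, (y.2 - e' * (y.1 / a) ^ k) / b)

lemma triInv_leftInverse {k : ℕ} {a b e e' : ℂ} (ha : a ≠ 0) (hb : b ≠ 0) (he : e = 0 ∨ e' = 0) :
    Function.LeftInverse (triInv k a b e e') (triMap k a b e e') := by
  rintro ⟨x, y⟩
  rcases he with rfl | rfl <;> simp [triMap, triInv, ha, hb]

lemma triInv_rightInverse {k : ℕ} {a b e e' : ℂ} (ha : a ≠ 0) (hb : b ≠ 0) (he : e = 0 ∨ e' = 0) :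
    Function.RightInverse (triInv k a b e e') (triMap k a b e e') := by
  rintro ⟨x, y⟩
  rcases he with rfl | rfl <;> simp [triMap, triInv, mul_div_cancel₀, ha, hb]

lemma analyticAt_triMap (k : ℕ) (a b e e' : ℂ) (x : ℂ × ℂ) :
    AnalyticAt ℂ (triMap k a b e e') x :=
  ((analyticAt_const.mul analyticAt_fst).add (analyticAt_const.mul (analyticAt_snd.pow k))).prod
    ((analyticAt_const.mul analyticAt_snd).add (analyticAt_const.mul (analyticAt_fst.pow k)))

lemma analyticAt_triInv (k : ℕ) (a b e e' : ℂ) (x : ℂ × ℂ) :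
    AnalyticAt ℂ (triInv k a b e e') x := by
  unfold triInv
  simp only [div_eq_mul_inv]
  exact ((analyticAt_fst.sub (analyticAt_const.mul
    ((analyticAt_snd.mul analyticAt_const).pow k))).mul analyticAt_const).prod
    ((analyticAt_snd.sub (analyticAt_const.mul
    ((analyticAt_fst.mul analyticAt_const).pow k))).mul analyticAt_const)

lemma norm_triMap_le {k : ℕ} (hk : 1 ≤ k) {a b e e' : ℂ} {D η : ℝ} (ha : ‖a‖ ≤ D) (hb : ‖b‖ ≤ D)
    (he : ‖e‖ ≤ η) (he' : ‖e'‖ ≤ η) {x : ℂ × ℂ} (hx : ‖x‖ ≤ 1) :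
    ‖triMap k a b e e' x‖ ≤ (D + η) * ‖x‖ := by
  have key : ∀ {a e u v : ℂ}, ‖a‖ ≤ D → ‖e‖ ≤ η → ‖u‖ ≤ ‖x‖ → ‖v‖ ≤ ‖x‖ →
      ‖a * u + e * v ^ k‖ ≤ (D + η) * ‖x‖ := by
    intro a e u v ha he hu hv
    have h1 : ‖v‖ ^ k ≤ ‖x‖ := by
      calc ‖v‖ ^ k ≤ ‖x‖ ^ k := by gcongr
        _ ≤ ‖x‖ ^ 1 := pow_le_pow_of_le_one (norm_nonneg _) hx hk
        _ = ‖x‖ := pow_one _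
    have h2 : ‖a * u‖ ≤ D * ‖x‖ := by
      rw [norm_mul]
      exact mul_le_mul ha hu (norm_nonneg _) ((norm_nonneg _).trans ha)
    have h3 : ‖e * v ^ k‖ ≤ η * ‖x‖ := by
      rw [norm_mul, norm_pow]
      exact mul_le_mul he h1 (by positivity) ((norm_nonneg _).trans he)
    linarith [norm_add_le (a * u) (e * v ^ k)]
  exact max_le (key ha he (norm_fst_le x) (norm_snd_le x))
    (key hb he' (norm_snd_le x) (norm_fst_le x))

lemma norm_triInv_sub_le {k : ℕ} {a b e e' : ℂ} {C η : ℝ} (hC : 0 < C) (ha : C ≤ ‖a‖)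
    (hb : C ≤ ‖b‖) (he : ‖e‖ ≤ η) (he' : ‖e'‖ ≤ η) {x y : ℂ × ℂ} (hx : ‖x‖ ≤ 1) (hy : ‖y‖ ≤ 1) :
    ‖triInv k a b e e' x - triInv k a b e e' y‖ ≤ (1 + η * k / C ^ k) / C * ‖x - y‖ := by
  have key : ∀ {a b e u v u' v' : ℂ}, C ≤ ‖a‖ → C ≤ ‖b‖ → ‖e‖ ≤ η → ‖u - u'‖ ≤ ‖x - y‖ →
      ‖v ^ k - v' ^ k‖ ≤ k * ‖x - y‖ → ‖(u - e * (v / b) ^ k) / a - (u' - e * (v' / b) ^ k) / a‖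
        ≤ (1 + η * k / C ^ k) / C * ‖x - y‖ := by
    intro a b e u v u' v' ha hb he hu hv
    have hη : 0 ≤ η := (norm_nonneg _).trans he
    have e1 : (u - e * (v / b) ^ k) / a - (u' - e * (v' / b) ^ k) / a =
        ((u - u') - e * ((v ^ k - v' ^ k) / b ^ k)) / a := by
      rw [div_pow, div_pow]; ring
    rw [e1, norm_div]
    have h1 : ‖e * ((v ^ k - v' ^ k) / b ^ k)‖ ≤ η * (k * ‖x - y‖ / C ^ k) := by
      rw [norm_mul, norm_div, norm_pow]
      gcongr
    calc _ ≤ (‖x - y‖ + η * (k * ‖x - y‖ / C ^ k)) / C := by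
          gcongr
          exact (norm_sub_le _ _).trans (add_le_add hu h1)
      _ = _ := by ring
  refine max_le (key ha hb he (norm_fst_le (x - y)) ?_) (key hb ha he' (norm_snd_le (x - y)) ?_)
  · simpa using norm_monomial_sub_le hx hy (zero_add k)
  · simpa using norm_monomial_sub_le hx hy (add_zero k)

lemma norm_conj_coord_le {k i j : ℕ} (hk : 2 ≤ k) (hij : i + j = k) {a e X t : ℂ} {c d p : ℕ → ℂ}
    {x y u l : ℂ × ℂ} {η b b₁ κ : ℝ} (hx : ‖x‖ ≤ 1) (hη : 0 ≤ η) (hb : 0 ≤ b) (hb₁ : 0 ≤ b₁)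
    (hid : a * homPoly k c x + e * (x.1 ^ i * x.2 ^ j) = homPoly k p x + homPoly k d l)
    (ht : ‖t - (a * X + homPoly k p x)‖ ≤ κ * ‖x‖ ^ (k + 1))
    (hy : ‖y - x‖ ≤ b * ‖x‖ ^ k) (hl : ‖l‖ ≤ ‖x‖) (hu : ‖u - l‖ ≤ b₁ * ‖x‖ ^ k)
    (he : ‖e‖ ≤ η) (hd : ∀ i ≤ k, ‖d i‖ ≤ η) :
    ‖(a * (X + homPoly k c x) + e * (y.1 ^ i * y.2 ^ j)) - (t + homPoly k d u)‖ ≤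
      (κ + η * (k * (1 + b) ^ (k - 1) * b) + (k + 1) * η * (k * (1 + b₁) ^ (k - 1) * b₁)) *
        ‖x‖ ^ (k + 1) := by
  have hxk : ‖x‖ ^ k ≤ ‖x‖ := by
    simpa using pow_le_pow_of_le_one (norm_nonneg x) hx (show 1 ≤ k by omega)
  have hpow : ‖x‖ ^ (k - 1) * ‖x‖ ^ k ≤ ‖x‖ ^ (k + 1) := by
    rw [← pow_add]
    exact pow_le_pow_of_le_one (norm_nonneg x) hx (by omega)
  have hyn : ‖y‖ ≤ (1 + b) * ‖x‖ := by
    have : ‖y‖ ≤ ‖x‖ + ‖y - x‖ := by simpa using norm_add_le x (y - x)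
    nlinarith
  have hun : ‖u‖ ≤ (1 + b₁) * ‖x‖ := by
    have : ‖u‖ ≤ ‖l‖ + ‖u - l‖ := by simpa using norm_add_le l (u - l)
    nlinarith
  have hxn : ‖x‖ ≤ (1 + b) * ‖x‖ := by nlinarith [norm_nonneg x]
  have hln : ‖l‖ ≤ (1 + b₁) * ‖x‖ := by nlinarith [norm_nonneg x]
  have e1 : (a * (X + homPoly k c x) + e * (y.1 ^ i * y.2 ^ j)) - (t + homPoly k d u) =
      e * (y.1 ^ i * y.2 ^ j - x.1 ^ i * x.2 ^ j) - (t - (a * X + homPoly k p x)) -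
        (homPoly k d u - homPoly k d l) := by
    linear_combination hid
  have h1 : ‖e * (y.1 ^ i * y.2 ^ j - x.1 ^ i * x.2 ^ j)‖ ≤
      η * (k * (1 + b) ^ (k - 1) * b) * ‖x‖ ^ (k + 1) := by
    rw [norm_mul]
    calc _ ≤ η * (k * ((1 + b) * ‖x‖) ^ (k - 1) * (b * ‖x‖ ^ k)) := by
          gcongr
          refine (norm_monomial_sub_le hyn hxn hij).trans ?_
          gcongr
      _ = η * (k * (1 + b) ^ (k - 1) * b) * (‖x‖ ^ (k - 1) * ‖x‖ ^ k) := by rw [mul_pow]; ring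
      _ ≤ _ := by gcongr
  have h2 : ‖homPoly k d u - homPoly k d l‖ ≤
      (k + 1) * η * (k * (1 + b₁) ^ (k - 1) * b₁) * ‖x‖ ^ (k + 1) := by
    calc _ ≤ (k + 1) * η * (k * ((1 + b₁) * ‖x‖) ^ (k - 1) * (b₁ * ‖x‖ ^ k)) := by
          refine (norm_homPoly_sub_le hd hun hln).trans ?_
          gcongr
      _ = (k + 1) * η * (k * (1 + b₁) ^ (k - 1) * b₁) * (‖x‖ ^ (k - 1) * ‖x‖ ^ k) := by
          rw [mul_pow]; ring
      _ ≤ _ := by gcongr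
  rw [e1]
  refine (norm_sub_le _ _).trans ?_
  have := norm_sub_le (e * (y.1 ^ i * y.2 ^ j - x.1 ^ i * x.2 ^ j)) (t - (a * X + homPoly k p x))
  linarith

lemma exists_coeff_family {k j : ℕ} (hj : j ≤ k) {C D κ : ℝ} (hC : 0 < C) (hD0 : 0 ≤ D)
    (hD : D < 1) {a α β : ℕ → ℂ} {p : ℕ → ℕ → ℂ} {S : Set ℕ} (ha : ∀ n, C ≤ ‖a n‖)
    (hα : ∀ n, ‖α n‖ ≤ 1) (hβ : ∀ n, ‖β n‖ ≤ 1)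
    (hm : ∀ i ≤ k, i ≠ j → ∀ n, ‖α n ^ i * β n ^ (k - i)‖ ≤ D * ‖a n‖)
    (hS : ∀ n, n ∉ S → ‖α n ^ j * β n ^ (k - j)‖ ≤ D * ‖a n‖)
    (hp : ∀ n, ∀ i ≤ k, ‖p n i‖ ≤ κ) :
    ∃ (c : ℕ → ℕ → ℂ) (e : ℕ → ℂ), (∀ n, n ∉ S → e n = 0) ∧
      (∀ n, ‖e n‖ ≤ κ * (1 + 1 / (C * (1 - D)))) ∧
      (∀ n, ∀ i ≤ k, ‖c n i‖ ≤ κ * (1 + 1 / (C * (1 - D)))) ∧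
      ∀ n x, a n * homPoly k (c n) x + e n * (x.1 ^ j * x.2 ^ (k - j)) =
        homPoly k (p n) x + homPoly k (c (n + 1)) (α n * x.1, β n * x.2) := by
  classical
  have h : ∀ i : ℕ, ∃ c e : ℕ → ℂ, i ≤ k →
      (∀ n, a n * c n + e n = p n i + α n ^ i * β n ^ (k - i) * c (n + 1)) ∧
      (∀ n, n ∉ (if i = j then S else ∅) → e n = 0) ∧
      (∀ n, ‖c n‖ ≤ κ * (1 + 1 / (C * (1 - D)))) ∧
      ∀ n, ‖e n‖ ≤ κ * (1 + 1 / (C * (1 - D))) := by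
    intro i
    by_cases hi : i ≤ k
    · obtain ⟨c, e, h⟩ := exists_coeff (a := a) (m := fun n => α n ^ i * β n ^ (k - i))
        (p := fun n => p n i) (C := C) (ρ := D) (K := κ) (if i = j then S else ∅) hC hD0 hD ha
        (fun n => by
          rw [norm_mul, norm_pow, norm_pow]
          exact mul_le_one₀ (pow_le_one₀ (norm_nonneg _) (hα n)) (by positivity)
            (pow_le_one₀ (norm_nonneg _) (hβ n)))
        (fun n hn => by
          by_cases hij : i = j
          · subst hij
            exact hS n (by simpa using hn)
          · exact hm i hi hij n)
        (fun n => hp n i hi)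
      exact ⟨c, e, fun _ => h⟩
    · exact ⟨0, 0, fun h => absurd h hi⟩
  choose c e h using h
  refine ⟨fun n i => c i n, fun n => e j n, fun n hn => ?_, fun n => (h j hj).2.2.2 n,
    fun n i hi => (h i hi).2.2.1 n, fun n x => ?_⟩
  · exact (h j hj).2.1 n (by simpa using hn)
  · have h1 : e j n * (x.1 ^ j * x.2 ^ (k - j)) =
        homPoly k (fun i => if i ≤ k then e i n else 0) x := by
      rw [homPoly_eq_single hj]
      · simp [hj]
      · intro i hi
        by_cases hik : i ≤ k
        · simpa [hik] using (h i hik).2.1 n (by simp [hi])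
        · simp [hik]
    rw [h1, homPoly_diag]
    unfold homPoly
    rw [Finset.mul_sum, ← Finset.sum_add_distrib, ← Finset.sum_add_distrib]
    refine Finset.sum_congr rfl fun i hi => ?_
    have hi' : i ≤ k := by simpa [Nat.lt_succ_iff] using hi
    have := (h i hi').1 n
    simp only [hi', if_true]
    linear_combination (x.1 ^ i * x.2 ^ (k - i)) * this

/-- Removal of the degree `k` terms of a sequence of germs with diagonal linear part, except for
one resonant monomial at certain steps. -/
theorem exists_normal_form {k : ℕ} (hk : 2 ≤ k) {C D κ κ₁ : ℝ} (hC : 0 < C) (hD0 : 0 ≤ D)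
    (hD : D < 1) {α β : ℕ → ℂ} {p p' : ℕ → ℕ → ℂ} {F : ℕ → ℂ × ℂ → ℂ × ℂ} {S S' : Set ℕ}
    (hα : ∀ n, C ≤ ‖α n‖) (hβ : ∀ n, C ≤ ‖β n‖) (hαD : ∀ n, ‖α n‖ ≤ D) (hβD : ∀ n, ‖β n‖ ≤ D)
    (hS : ∀ n, n ∉ S → ‖β n‖ ^ k ≤ D * ‖α n‖) (hS' : ∀ n, n ∉ S' → ‖α n‖ ^ k ≤ D * ‖β n‖)
    (hp : ∀ n, ∀ i ≤ k, ‖p n i‖ ≤ κ) (hp' : ∀ n, ∀ i ≤ k, ‖p' n i‖ ≤ κ) (hκ₁ : 0 ≤ κ₁)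
    (hF : ∀ n x, ‖x‖ ≤ 1 → ‖F n x - (α n * x.1 + homPoly k (p n) x,
      β n * x.2 + homPoly k (p' n) x)‖ ≤ κ₁ * ‖x‖ ^ (k + 1)) :
    ∃ (e e' : ℕ → ℂ) (h : ℕ → ℂ × ℂ → ℂ × ℂ), (∀ n, n ∉ S → e n = 0) ∧ (∀ n, n ∉ S' → e' n = 0) ∧
      (∀ n, ‖e n‖ ≤ κ * (1 + 1 / (C * (1 - D)))) ∧ (∀ n, ‖e' n‖ ≤ κ * (1 + 1 / (C * (1 - D)))) ∧
      (∀ n x, AnalyticAt ℂ (h n) x) ∧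
      (∃ κ' ≥ 0, ∀ n x, ‖x‖ ≤ 1 → ‖h n x - x‖ ≤ κ' * ‖x‖ ^ 2) ∧
      ∃ K ≥ 0, ∀ n x, ‖x‖ ≤ 1 → ‖triMap k (α n) (β n) (e n) (e' n) (h n x) - h (n + 1) (F n x)‖ ≤
        K * ‖x‖ ^ (k + 1) := by
  have hpowD : ∀ {a b : ℂ} {i j : ℕ}, ‖a‖ ≤ D → ‖b‖ ≤ D → 1 ≤ i → i + j = k →
      ‖a ^ i * b ^ j‖ ≤ D * ‖a‖ := by
    intro a b i j ha hb hi hij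
    obtain ⟨i, rfl⟩ : ∃ i', i = i' + 1 := ⟨i - 1, by omega⟩
    rw [norm_mul, norm_pow, norm_pow, pow_succ]
    have h1 : ‖a‖ ^ i * ‖b‖ ^ j ≤ D := by
      calc ‖a‖ ^ i * ‖b‖ ^ j ≤ D ^ i * D ^ j := by gcongr
        _ = D ^ (i + j) := (pow_add _ _ _).symm
        _ ≤ D ^ 1 := pow_le_pow_of_le_one hD0 hD.le (by omega)
        _ = D := pow_one D
    nlinarith [norm_nonneg a]
  have hκ : 0 ≤ κ := (norm_nonneg _).trans (hp 0 0 (Nat.zero_le _))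
  have h1D : 0 < 1 - D := by linarith
  obtain ⟨c, e, heS, heb, hcb, hce⟩ := exists_coeff_family (j := 0) (Nat.zero_le k) hC hD0 hD
    (a := α) (α := α) (β := β) (p := p) (S := S) hα (fun n => (hαD n).trans hD.le)
    (fun n => (hβD n).trans hD.le)
    (fun i hi hi0 n => hpowD (hαD n) (hβD n) (by omega) (by omega))
    (fun n hn => by simpa using hS n hn) hp
  obtain ⟨c', e', heS', heb', hcb', hce'⟩ := exists_coeff_family (j := k) le_rfl hC hD0 hD
    (a := β) (α := α) (β := β) (p := p') (S := S') hβ (fun n => (hαD n).trans hD.le)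
    (fun n => (hβD n).trans hD.le)
    (fun i hi hi0 n => by
      rw [mul_comm]; exact hpowD (hβD n) (hαD n) (by omega) (by omega))
    (fun n hn => by simpa using hS' n hn) hp'
  set η := κ * (1 + 1 / (C * (1 - D))) with hη
  have hη0 : 0 ≤ η := by positivity
  set b := (k + 1) * η with hb
  have hb0 : 0 ≤ b := by positivity
  set b₁ := (k + 1) * κ + κ₁ with hb₁
  have hb₁0 : 0 ≤ b₁ := by positivity
  have hhx : ∀ n x, ‖(x.1 + homPoly k (c n) x, x.2 + homPoly k (c' n) x) - x‖ ≤ b * ‖x‖ ^ k := by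
    intro n x
    refine max_le ?_ ?_
    · simpa using norm_homPoly_le (hcb n) x
    · simpa using norm_homPoly_le (hcb' n) x
  refine ⟨e, e', fun n x => (x.1 + homPoly k (c n) x, x.2 + homPoly k (c' n) x), heS, heS', heb,
    heb', fun n x => (analyticAt_fst.add (analyticAt_homPoly _ _ _)).prod
      (analyticAt_snd.add (analyticAt_homPoly _ _ _)), ⟨b, hb0, fun n x hx => ?_⟩,
    κ₁ + η * (k * (1 + b) ^ (k - 1) * b) + (k + 1) * η * (k * (1 + b₁) ^ (k - 1) * b₁),
    by positivity, fun n x hx => ?_⟩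
  · refine (hhx n x).trans ?_
    exact mul_le_mul_of_nonneg_left (pow_le_pow_of_le_one (norm_nonneg _) hx hk) hb0
  · have hl : ‖((α n * x.1, β n * x.2) : ℂ × ℂ)‖ ≤ ‖x‖ := by
      refine max_le ?_ ?_
      · rw [norm_mul]
        exact (mul_le_of_le_one_left (norm_nonneg _) ((hαD n).trans hD.le)).trans (norm_fst_le x)
      · rw [norm_mul]
        exact (mul_le_of_le_one_left (norm_nonneg _) ((hβD n).trans hD.le)).trans (norm_snd_le x)
    have hu : ‖F n x - (α n * x.1, β n * x.2)‖ ≤ b₁ * ‖x‖ ^ k := by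
      have h1 : ‖((homPoly k (p n) x, homPoly k (p' n) x) : ℂ × ℂ)‖ ≤ (k + 1) * κ * ‖x‖ ^ k :=
        max_le (norm_homPoly_le (hp n) x) (norm_homPoly_le (hp' n) x)
      have h2 := norm_add_le (F n x - (α n * x.1 + homPoly k (p n) x,
        β n * x.2 + homPoly k (p' n) x)) (homPoly k (p n) x, homPoly k (p' n) x)
      have h3 : F n x - (α n * x.1 + homPoly k (p n) x, β n * x.2 + homPoly k (p' n) x) +
          (homPoly k (p n) x, homPoly k (p' n) x) = F n x - (α n * x.1, β n * x.2) := by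
        ext <;> simp <;> ring
      rw [h3] at h2
      have h4 : κ₁ * ‖x‖ ^ (k + 1) ≤ κ₁ * ‖x‖ ^ k :=
        mul_le_mul_of_nonneg_left (pow_le_pow_of_le_one (norm_nonneg _) hx (by omega)) hκ₁
      have := hF n x hx
      rw [hb₁]
      linarith
    have hF1 : ‖(F n x).1 - (α n * x.1 + homPoly k (p n) x)‖ ≤ κ₁ * ‖x‖ ^ (k + 1) :=
      (norm_fst_le (F n x - (α n * x.1 + homPoly k (p n) x,
        β n * x.2 + homPoly k (p' n) x))).trans (hF n x hx)
    have hF2 : ‖(F n x).2 - (β n * x.2 + homPoly k (p' n) x)‖ ≤ κ₁ * ‖x‖ ^ (k + 1) :=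
      (norm_snd_le (F n x - (α n * x.1 + homPoly k (p n) x,
        β n * x.2 + homPoly k (p' n) x))).trans (hF n x hx)
    have hA := norm_conj_coord_le hk (show 0 + (k - 0) = k by omega) hx hη0 hb0 hb₁0
      (hce n x) hF1 (hhx n x) hl hu (heb n) (hcb (n + 1))
    have hB := norm_conj_coord_le hk (show k + (k - k) = k by omega) hx hη0 hb0 hb₁0
      (hce' n x) hF2 (hhx n x) hl hu (heb' n) (hcb' (n + 1))
    refine max_le ?_ ?_
    · simpa [triMap] using hA
    · simpa [triMap] using hB

lemma exists_norm_orb_lt {F : ℕ → ℂ × ℂ → ℂ × ℂ} {δ ρ : ℝ} (hδ0 : 0 ≤ δ) (hδ : δ < 1) (hρ : 0 < ρ)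
    (hF : ∀ n x, ‖x‖ ≤ 1 → ‖F n x‖ ≤ δ * ‖x‖) {n : ℕ} {x : ℂ × ℂ} (hx : ‖orb F n x‖ ≤ 1) :
    ∃ m, ‖orb F m x‖ < ρ := by
  have h : ∀ j, ‖orb F (n + j) x‖ ≤ δ ^ j := by
    intro j
    induction j with
    | zero => simpa using hx
    | succ j ih =>
      have h1 : ‖orb F (n + j) x‖ ≤ 1 := ih.trans (pow_le_one₀ hδ0 hδ.le)
      calc ‖orb F (n + (j + 1)) x‖ ≤ δ * ‖orb F (n + j) x‖ := hF _ _ h1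
        _ ≤ δ * δ ^ j := by gcongr
        _ = δ ^ (j + 1) := by ring
  obtain ⟨j, hj⟩ := exists_pow_lt_of_lt_one hρ hδ
  exact ⟨n + j, (h j).trans_lt hj⟩

lemma exists_sum_one_div_gt (c : ℝ) : ∃ n, c < ∑ i ∈ Finset.range n, (1 / ((i : ℝ) + 1)) :=
  (Real.tendsto_sum_range_one_div_nat_succ_atTop.eventually_gt_atTop c).exists

/-- One step of the weighted estimate: a point of size `exp (λ σ)` is mapped to a point of size
`exp ((λ - d / A) σ')`. -/
lemma norm_tri_coord_le {k : ℕ} {a e u v : ℂ} {D η lam σ τ σ' d A : ℝ} (hlam : 0 ≤ lam)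
    (ha : ‖a‖ ≤ D) (he : ‖e‖ ≤ η) (hd : D + η ≤ Real.exp (-d)) (hd0 : 0 ≤ d) (hA : 0 < A)
    (hσA : σ' ≤ A) (hσ : σ ≤ σ') (hτ : e = 0 ∨ k * τ ≤ σ')
    (hu : ‖u‖ ≤ Real.exp (lam * σ)) (hv : ‖v‖ ≤ Real.exp (lam * τ)) :
    ‖a * u + e * v ^ k‖ ≤ Real.exp ((lam - d / A) * σ') := by
  have hE := Real.exp_pos (lam * σ')
  have h1 : ‖a * u‖ ≤ D * Real.exp (lam * σ') := by
    rw [norm_mul]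
    refine mul_le_mul ha (hu.trans ?_) (norm_nonneg _) ((norm_nonneg _).trans ha)
    gcongr
  have h2 : ‖e * v ^ k‖ ≤ η * Real.exp (lam * σ') := by
    rcases hτ with rfl | hτ
    · simp only [zero_mul, norm_zero]
      have := (norm_nonneg _).trans he
      positivity
    · rw [norm_mul, norm_pow]
      refine mul_le_mul he ?_ (by positivity) ((norm_nonneg _).trans he)
      calc ‖v‖ ^ k ≤ Real.exp (lam * τ) ^ k := by gcongr
        _ = Real.exp (lam * (k * τ)) := by rw [← Real.exp_nat_mul]; ring_nf
        _ ≤ _ := by gcongr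
  calc ‖a * u + e * v ^ k‖ ≤ (D + η) * Real.exp (lam * σ') := by
        linarith [norm_add_le (a * u) (e * v ^ k)]
    _ ≤ Real.exp (-d) * Real.exp (lam * σ') := by gcongr
    _ = Real.exp (-d + lam * σ') := (Real.exp_add _ _).symm
    _ ≤ _ := by
      gcongr
      have : d / A * σ' ≤ d / A * A := by gcongr
      rw [div_mul_cancel₀ _ hA.ne'] at this
      linarith

theorem exists_orb_triMap_lt {k : ℕ} (hk : 1 ≤ k) {α β e e' : ℕ → ℂ} {D η A ρ : ℝ} {σ τ : ℕ → ℝ}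
    {S S' : Set ℕ} (hD : 0 < D) (hη : 0 ≤ η) (hDη : D + η < 1) (hα : ∀ n, ‖α n‖ ≤ D)
    (hβ : ∀ n, ‖β n‖ ≤ D) (he : ∀ n, ‖e n‖ ≤ η) (he' : ∀ n, ‖e' n‖ ≤ η)
    (heS : ∀ n, n ∉ S → e n = 0) (heS' : ∀ n, n ∉ S' → e' n = 0)
    (hS : ∀ n ∈ S, k * τ n ≤ σ (n + 1)) (hS' : ∀ n ∈ S', k * σ n ≤ τ (n + 1))
    (hσ0 : 1 ≤ σ 0) (hτ0 : 1 ≤ τ 0) (hσ : ∀ n, σ n ≤ σ (n + 1)) (hτ : ∀ n, τ n ≤ τ (n + 1))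
    (hA : 0 < A) (hσA : ∀ n, σ (n + 1) ≤ A * (n + 1)) (hτA : ∀ n, τ (n + 1) ≤ A * (n + 1))
    (hρ : 0 < ρ) (y : ℂ × ℂ) :
    ∃ n, ‖orb (fun n => triMap k (α n) (β n) (e n) (e' n)) n y‖ < ρ := by
  classical
  suffices h : ∃ n, ‖orb (fun n => triMap k (α n) (β n) (e n) (e' n)) n y‖ ≤ 1 by
    obtain ⟨n, hn⟩ := h
    exact exists_norm_orb_lt (by linarith) hDη hρ
      (fun n x hx => norm_triMap_le hk (hα n) (hβ n) (he n) (he' n) hx) hn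
  by_contra! hcon
  set G := fun n => triMap k (α n) (β n) (e n) (e' n) with hG
  set d := -Real.log (D + η) with hd
  have hd0 : 0 < d := by
    have := Real.log_neg (by linarith) hDη
    linarith
  have hde : D + η ≤ Real.exp (-d) := by
    rw [hd, neg_neg, Real.exp_log (by linarith)]
  set lam : ℕ → ℝ := fun n => ‖y‖ - d / A * ∑ i ∈ Finset.range n, (1 / ((i : ℝ) + 1)) with hlam
  have hσ1 : ∀ n, 1 ≤ σ n := fun n => hσ0.trans (monotone_nat_of_le_succ hσ (Nat.zero_le n))
  have hτ1 : ∀ n, 1 ≤ τ n := fun n => hτ0.trans (monotone_nat_of_le_succ hτ (Nat.zero_le n))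
  have key : ∀ n, ‖(orb G n y).1‖ ≤ Real.exp (lam n * σ n) ∧
      ‖(orb G n y).2‖ ≤ Real.exp (lam n * τ n) := by
    intro n
    induction n with
    | zero =>
      have h0 : lam 0 = ‖y‖ := by simp [hlam]
      have h1 := Real.add_one_le_exp (‖y‖ * σ 0)
      have h2 := Real.add_one_le_exp (‖y‖ * τ 0)
      have h3 := norm_fst_le y
      have h4 := norm_snd_le y
      rw [h0]
      constructor
      · change ‖y.1‖ ≤ _
        nlinarith [norm_nonneg y]
      · change ‖y.2‖ ≤ _
        nlinarith [norm_nonneg y]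
    | succ n ih =>
      have hl : 0 ≤ lam n := by
        by_contra! hneg
        refine absurd (hcon n) (not_lt.2 (max_le (ih.1.trans ?_) (ih.2.trans ?_)))
        · exact Real.exp_le_one_iff.2 (mul_nonpos_of_nonpos_of_nonneg hneg.le (by linarith [hσ1 n]))
        · exact Real.exp_le_one_iff.2 (mul_nonpos_of_nonpos_of_nonneg hneg.le (by linarith [hτ1 n]))
      have hs : lam (n + 1) = lam n - d / (A * (n + 1)) := by
        simp only [hlam, Finset.sum_range_succ]
        field_simp
        ring
      rw [hs]
      have hA' : 0 < A * ((n : ℝ) + 1) := by positivity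
      constructor
      · refine norm_tri_coord_le hl (hα n) (he n) hde hd0.le hA' (hσA n) (hσ n) ?_ ih.1 ih.2
        by_cases hn : n ∈ S
        exacts [Or.inr (hS n hn), Or.inl (heS n hn)]
      · refine norm_tri_coord_le hl (hβ n) (he' n) hde hd0.le hA' (hτA n) (hτ n) ?_ ih.2 ih.1
        by_cases hn : n ∈ S'
        exacts [Or.inr (hS' n hn), Or.inl (heS' n hn)]
  obtain ⟨n, hn⟩ := exists_sum_one_div_gt (‖y‖ / (d / A))
  have hneg : lam n < 0 := by
    have h : 0 < d / A := by positivity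
    rw [div_lt_iff₀ h] at hn
    simp only [hlam]
    linarith
  refine absurd (hcon n) (not_lt.2 (max_le ((key n).1.trans ?_) ((key n).2.trans ?_)))
  · exact Real.exp_le_one_iff.2 (mul_nonpos_of_nonpos_of_nonneg hneg.le (by linarith [hσ1 n]))
  · exact Real.exp_le_one_iff.2 (mul_nonpos_of_nonpos_of_nonneg hneg.le (by linarith [hτ1 n]))

/-- The basin of a sequence in weighted coordinates, expressed as the set of points whose orbit
enters a small ball, is biholomorphic to `ℂ²`. -/
theorem biholomorphicTo_of_weighted {k : ℕ} (hk : 2 ≤ k) {C D δ κ κ₁ A : ℝ} (hC : 0 < C)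
    (hD0 : 0 < D) (hD : D < 1) (hκ : 0 ≤ κ) (hκ₁ : 0 ≤ κ₁) (hδ : δ < 1)
    (hDδ : D + κ * (1 + 1 / (C * (1 - D))) ≤ δ)
    (hCδ : (1 + κ * (1 + 1 / (C * (1 - D))) * k / C ^ k) / C * δ ^ (k + 1) < 1)
    {α β : ℕ → ℂ} {p p' : ℕ → ℕ → ℂ} {F Fi : ℕ → ℂ × ℂ → ℂ × ℂ} {S S' : Set ℕ} {σ τ : ℕ → ℝ}
    (hFa : ∀ n x, AnalyticAt ℂ (F n) x) (hFia : ∀ n x, AnalyticAt ℂ (Fi n) x)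
    (hFl : ∀ n, Function.LeftInverse (Fi n) (F n)) (hFr : ∀ n, Function.RightInverse (Fi n) (F n))
    (hFδ : ∀ n x, ‖x‖ ≤ 1 → ‖F n x‖ ≤ δ * ‖x‖)
    (hα : ∀ n, C ≤ ‖α n‖) (hβ : ∀ n, C ≤ ‖β n‖) (hαD : ∀ n, ‖α n‖ ≤ D) (hβD : ∀ n, ‖β n‖ ≤ D)
    (hS : ∀ n, n ∉ S → ‖β n‖ ^ k ≤ D * ‖α n‖) (hS' : ∀ n, n ∉ S' → ‖α n‖ ^ k ≤ D * ‖β n‖)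
    (hSS' : Disjoint S S')
    (hp : ∀ n, ∀ i ≤ k, ‖p n i‖ ≤ κ) (hp' : ∀ n, ∀ i ≤ k, ‖p' n i‖ ≤ κ)
    (hF : ∀ n x, ‖x‖ ≤ 1 → ‖F n x - (α n * x.1 + homPoly k (p n) x,
      β n * x.2 + homPoly k (p' n) x)‖ ≤ κ₁ * ‖x‖ ^ (k + 1))
    (hSσ : ∀ n ∈ S, k * τ n ≤ σ (n + 1)) (hSτ : ∀ n ∈ S', k * σ n ≤ τ (n + 1))
    (hσ0 : 1 ≤ σ 0) (hτ0 : 1 ≤ τ 0) (hσ : ∀ n, σ n ≤ σ (n + 1)) (hτ : ∀ n, τ n ≤ τ (n + 1))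
    (hA : 0 < A) (hσA : ∀ n, σ (n + 1) ≤ A * (n + 1)) (hτA : ∀ n, τ (n + 1) ≤ A * (n + 1)) :
    ∃ ρ > 0, ρ ≤ 1 ∧ BiholomorphicTo {x | ∃ n, orb F n x ∈ ball 0 ρ} univ := by
  have h1D : 0 < 1 - D := by linarith
  set η := κ * (1 + 1 / (C * (1 - D))) with hη
  have hη0 : 0 ≤ η := by positivity
  have hδ0 : 0 ≤ δ := by linarith
  obtain ⟨e, e', h, heS, heS', he, he', hha, ⟨κ', hκ'0, hκ'⟩, K, hK0, hK⟩ :=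
    exists_normal_form hk hC hD0.le hD hα hβ hαD hβD hS hS' hp hp' hκ₁ hF
  have hα0 : ∀ n, α n ≠ 0 := fun n => norm_pos_iff.1 (hC.trans_le (hα n))
  have hβ0 : ∀ n, β n ≠ 0 := fun n => norm_pos_iff.1 (hC.trans_le (hβ n))
  have hee : ∀ n, e n = 0 ∨ e' n = 0 := by
    intro n
    by_cases hn : n ∈ S
    · exact Or.inr (heS' n fun h => disjoint_left.1 hSS' hn h)
    · exact Or.inl (heS n hn)
  set G := fun n => triMap k (α n) (β n) (e n) (e' n) with hG
  set Gi := fun n => triInv k (α n) (β n) (e n) (e' n) with hGi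
  have hGl : ∀ n, Function.LeftInverse (Gi n) (G n) := fun n =>
    triInv_leftInverse (hα0 n) (hβ0 n) (hee n)
  have hGr : ∀ n, Function.RightInverse (Gi n) (G n) := fun n =>
    triInv_rightInverse (hα0 n) (hβ0 n) (hee n)
  have hGδ : ∀ n x, ‖x‖ ≤ 1 → ‖G n x‖ ≤ δ * ‖x‖ := fun n x hx =>
    (norm_triMap_le (by omega) (hαD n) (hβD n) (he n) (he' n) hx).trans (by gcongr)
  obtain ⟨r, hr, M, hM, Φ, hr1, hΦa, hΦM, hconj⟩ := exists_local_conj (F := F) (h := h) (G := G)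
    (Gi := Gi) (k := k) (by omega) hδ0 hδ (by positivity) hCδ hκ'0 hK0 hFa hha
    (fun n => analyticAt_triInv _ _ _ _ _) hGl hGr hFδ hκ' hK
    (fun n x y hx hy => norm_triInv_sub_le hC (hα n) (hβ n) (he n) (he' n) hx hy)
  set ρ := min (r / 2) (1 / (16 * (M + 1))) with hρ
  have hρ0 : 0 < ρ := by positivity
  have hρr : 2 * ρ ≤ r := by
    have : ρ ≤ r / 2 := min_le_left _ _
    linarith
  have hMρ : 16 * M * ρ ≤ 1 := by
    have h1 : ρ ≤ 1 / (16 * (M + 1)) := min_le_right _ _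
    rw [le_div_iff₀ (by positivity)] at h1
    nlinarith
  have hinv := fun n => exists_local_inverse (hΦa n) hM (hΦM n) hρ0 hρr hMρ
  choose hinj Ψ hΨa hΨm hΨ using hinv
  have hmaps : ∀ {T : ℕ → ℂ × ℂ → ℂ × ℂ} {s : ℝ}, s ≤ 1 → (∀ n x, ‖x‖ ≤ 1 → ‖T n x‖ ≤ δ * ‖x‖) →
      ∀ n, MapsTo (T n) (ball 0 s) (ball 0 s) := by
    intro T s hs hT n x hx
    rw [mem_ball_zero_iff] at hx ⊢
    nlinarith [hT n x (by linarith), norm_nonneg x]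
  refine ⟨ρ, hρ0, by linarith, biholomorphicTo_of_local_conj (G := G) (Gi := Gi) (Φ := Φ) (Ψ := Ψ)
    isOpen_ball isOpen_ball hFa hFia hFl hFr (fun n => analyticAt_triMap _ _ _ _ _)
    (fun n => analyticAt_triInv _ _ _ _ _) hGl hGr
    (fun n => (hΦa n).mono (ball_subset_ball (by linarith))) hΨa hinj hΨm hΨ
    (hmaps (by linarith) hFδ) (hmaps (by linarith) hGδ)
    (fun n x hx => hconj n x (ball_subset_ball (by linarith) hx)) fun y => ?_⟩
  obtain ⟨n, hn⟩ := exists_orb_triMap_lt (by omega) hD0 hη0 (hDδ.trans_lt hδ) hαD hβD he he' heS heS'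
    hSσ hSτ hσ0 hτ0 hσ hτ hA hσA hτA (show 0 < ρ / 4 by positivity) y
  exact ⟨n, mem_ball_zero_iff.2 hn⟩

/-- The restriction of a multilinear form in `k` vectors of `ℂ²` to the diagonal is a binary
form. -/
lemma exists_homPoly_eq {k : ℕ} (p : ContinuousMultilinearMap ℂ (fun _ : Fin k => ℂ × ℂ) ℂ) :
    ∃ q : ℕ → ℂ, ∀ x, p (fun _ => x) = homPoly k q x := by
  classical
  refine ⟨fun i => ∑ s : Finset (Fin k) with s.card = i,
    p (s.piecewise (fun _ => (1, 0)) (fun _ => (0, 1))), fun x => ?_⟩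
  have h1 : (fun _ : Fin k => x) =
      (fun _ => (x.1, 0)) + (fun _ => ((0, x.2) : ℂ × ℂ)) := by
    funext i; simp
  have h2 : ∀ s : Finset (Fin k), p (s.piecewise (fun _ => (x.1, 0)) (fun _ => (0, x.2))) =
      x.1 ^ s.card * x.2 ^ (k - s.card) *
        p (s.piecewise (fun _ => (1, 0)) (fun _ => (0, 1))) := by
    intro s
    have h3 : s.piecewise (fun _ => ((x.1, 0) : ℂ × ℂ)) (fun _ => (0, x.2)) =
        fun i => (if i ∈ s then x.1 else x.2) •
          s.piecewise (fun _ => ((1, 0) : ℂ × ℂ)) (fun _ => (0, 1)) i := by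
      funext i
      by_cases hi : i ∈ s <;> simp [hi]
    rw [h3, ContinuousMultilinearMap.map_smul_univ, smul_eq_mul, Finset.prod_ite]
    congr 1
    simp [Finset.filter_not, Finset.card_sdiff_of_subset]
  rw [h1, ContinuousMultilinearMap.map_add_univ]
  simp only [h2]
  rw [← Finset.sum_fiberwise_of_maps_to (t := Finset.range (k + 1)) (g := Finset.card)
    (fun s _ => Finset.mem_range.2 (Nat.lt_succ_of_le (by simpa using s.card_le_univ)))]
  refine Finset.sum_congr rfl fun i _ => ?_
  rw [Finset.sum_mul]
  refine Finset.sum_congr rfl fun s hs => ?_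
  rw [(Finset.mem_filter.1 hs).2]
  ring

lemma iteratedDeriv_polynomial_eval (n : ℕ) (Q : Polynomial ℂ) :
    iteratedDeriv n (fun x => Q.eval x) = fun x => (Polynomial.derivative^[n] Q).eval x := by
  induction n with
  | zero => simp
  | succ n ih =>
    rw [iteratedDeriv_succ, ih, Function.iterate_succ_apply']
    funext x
    rw [Polynomial.deriv]

/-- Cauchy's estimate for the coefficients of a polynomial. -/
lemma norm_polynomial_coeff_le {Q : Polynomial ℂ} {K : ℝ} (hQ : ∀ x : ℂ, ‖x‖ ≤ 1 → ‖Q.eval x‖ ≤ K)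
    (n : ℕ) : ‖Q.coeff n‖ ≤ K := by
  have h := Complex.norm_iteratedDeriv_le_of_forall_mem_sphere_norm_le (c := 0) (R := 1) (C := K)
    (f := fun x => Q.eval x) n one_pos Q.differentiable.diffContOnCl
    (fun z hz => hQ z (mem_sphere_zero_iff_norm.1 hz).le)
  rw [iteratedDeriv_polynomial_eval] at h
  beta_reduce at h
  rw [← Polynomial.coeff_zero_eq_eval_zero, Polynomial.coeff_iterate_derivative, zero_add,
    Nat.descFactorial_self, nsmul_eq_mul, norm_mul, Complex.norm_natCast, one_pow, div_one] at h
  exact le_of_mul_le_mul_left h (by positivity)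

lemma norm_coeff_le_of_homPoly {k : ℕ} {q : ℕ → ℂ} {K : ℝ}
    (hq : ∀ x, ‖homPoly k q x‖ ≤ K * ‖x‖ ^ k) {i : ℕ} (hi : i ≤ k) : ‖q i‖ ≤ K := by
  set Q : Polynomial ℂ := ∑ i ∈ Finset.range (k + 1), Polynomial.monomial i (q i) with hQ
  have h1 : ∀ x : ℂ, Q.eval x = homPoly k q (x, 1) := by
    intro x
    simp [hQ, Polynomial.eval_finsetSum, homPoly]
  have h2 : Q.coeff i = q i := by
    simp [hQ, Polynomial.coeff_monomial, Nat.lt_succ_of_le hi]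
  rw [← h2]
  refine norm_polynomial_coeff_le (fun x hx => ?_) i
  rw [h1]
  have h3 : ‖((x, 1) : ℂ × ℂ)‖ = 1 := by simp [Prod.norm_def, hx]
  simpa [h3] using hq (x, 1)

lemma homPoly_smul (k : ℕ) (q : ℕ → ℂ) (t : ℂ) (x : ℂ × ℂ) :
    homPoly k q (t • x) = t ^ k * homPoly k q x := by
  unfold homPoly
  rw [Finset.mul_sum]
  refine Finset.sum_congr rfl fun i hi => ?_
  have hi' : i ≤ k := by simpa [Nat.lt_succ_iff] using hi
  simp only [Prod.smul_fst, Prod.smul_snd, smul_eq_mul, mul_pow]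
  rw [show t ^ k = t ^ i * t ^ (k - i) by rw [← pow_add]; congr 1; omega]
  ring

lemma norm_le_of_isBigO_pow_succ {k : ℕ} {q : ℕ → ℂ} {g : ℂ × ℂ → ℂ} {K : ℝ}
    (hg : ∀ x, ‖x‖ < 1 → ‖g x‖ ≤ K * ‖x‖ ^ k)
    (ho : (fun x => g x - homPoly k q x) =O[𝓝 0] fun x => ‖x‖ ^ (k + 1)) (x : ℂ × ℂ) :
    ‖homPoly k q x‖ ≤ K * ‖x‖ ^ k := by
  obtain ⟨B, hB⟩ := ho.bound
  have ht : Tendsto (fun t : ℝ => (t : ℂ) • x) (𝓝[>] 0) (𝓝 0) := by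
    have : Continuous fun t : ℝ => (t : ℂ) • x := by fun_prop
    simpa using (this.tendsto 0).mono_left nhdsWithin_le_nhds
  have h1 : ∀ᶠ t : ℝ in 𝓝[>] 0, ‖homPoly k q x‖ ≤ K * ‖x‖ ^ k + B * ‖x‖ ^ (k + 1) * t := by
    filter_upwards [ht.eventually hB, ht.eventually (ball_mem_nhds 0 one_pos),
      self_mem_nhdsWithin] with t h2 h3 h4
    have h4' : (0 : ℝ) < t := h4
    have h5 := hg _ (mem_ball_zero_iff.1 h3)
    have h6 : ‖homPoly k q ((t : ℂ) • x)‖ ≤ ‖g ((t : ℂ) • x)‖ +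
        ‖g ((t : ℂ) • x) - homPoly k q ((t : ℂ) • x)‖ := by
      simpa using norm_sub_le (g ((t : ℂ) • x)) (g ((t : ℂ) • x) - homPoly k q ((t : ℂ) • x))
    have h7 : ‖((t : ℂ) • x)‖ = t * ‖x‖ := by
      rw [norm_smul, Complex.norm_real, Real.norm_of_nonneg h4'.le]
    rw [h7] at h2 h5
    rw [Real.norm_of_nonneg (by positivity)] at h2
    have h8 : ‖homPoly k q ((t : ℂ) • x)‖ = t ^ k * ‖homPoly k q x‖ := by
      rw [homPoly_smul, norm_mul, norm_pow, Complex.norm_real, Real.norm_of_nonneg h4'.le]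
    rw [h8] at h6
    have h9 : t ^ k * ‖homPoly k q x‖ ≤ t ^ k * (K * ‖x‖ ^ k + B * ‖x‖ ^ (k + 1) * t) := by
      refine (h6.trans (add_le_add h5 h2)).trans (le_of_eq ?_)
      ring
    exact le_of_mul_le_mul_left h9 (by positivity)
  have h2 : Tendsto (fun t : ℝ => K * ‖x‖ ^ k + B * ‖x‖ ^ (k + 1) * t) (𝓝[>] 0)
      (𝓝 (K * ‖x‖ ^ k)) := by
    have : Continuous fun t : ℝ => K * ‖x‖ ^ k + B * ‖x‖ ^ (k + 1) * t := by fun_prop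
    simpa using (this.tendsto 0).mono_left nhdsWithin_le_nhds
  exact ge_of_tendsto h2 h1

lemma exists_homPoly_isBigO {k : ℕ} {g : ℂ × ℂ → ℂ} (hg : AnalyticAt ℂ g 0)
    (ho : g =O[𝓝 0] fun x => ‖x‖ ^ k) :
    ∃ q : ℕ → ℂ, (fun x => g x - homPoly k q x) =O[𝓝 0] fun x => ‖x‖ ^ (k + 1) := by
  obtain ⟨p, hp⟩ := hg
  have hz : ∀ i < k, ∀ x, p i (fun _ => x) = 0 := by
    intro i
    induction i using Nat.strong_induction_on with
    | _ i ih =>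
      intro hi
      refine IsBigO.continuousMultilinearMap_apply_eq_zero ?_
      have h1 := hp.isBigO_sub_partialSum_pow (i + 1)
      have h2 : (fun x => g (0 + x)) =O[𝓝 0] fun x => ‖x‖ ^ (i + 1) := by
        simp only [zero_add]
        refine ho.trans (IsBigO.of_bound 1 ?_)
        filter_upwards [ball_mem_nhds (0 : ℂ × ℂ) one_pos] with x hx
        rw [mem_ball_zero_iff] at hx
        simp only [norm_pow, norm_norm, one_mul]
        exact pow_le_pow_of_le_one (norm_nonneg _) hx.le (by omega)
      refine (h2.sub h1).congr_left fun x => ?_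
      simp only [FormalMultilinearSeries.partialSum, sub_sub_cancel]
      rw [Finset.sum_range_succ, Finset.sum_eq_zero, zero_add]
      intro j hj
      have hj' := Finset.mem_range.1 hj
      exact ih j hj' (by omega) x
  obtain ⟨q, hq⟩ := exists_homPoly_eq (p k)
  refine ⟨q, (hp.isBigO_sub_partialSum_pow (k + 1)).congr_left fun x => ?_⟩
  simp only [FormalMultilinearSeries.partialSum, zero_add]
  rw [Finset.sum_range_succ, Finset.sum_eq_zero, zero_add, hq]
  intro j hj
  exact hz j (Finset.mem_range.1 hj) x

/-- The Taylor expansion to order `k` of a bounded function on the unit ball vanishing to order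
`k`, with explicit bounds. -/
lemma exists_homPoly_approx {k : ℕ} (hk : 1 ≤ k) {g : ℂ × ℂ → ℂ} {B : ℝ}
    (hg : ∀ x, AnalyticAt ℂ g x) (hB : ∀ x, ‖x‖ < 1 → ‖g x‖ ≤ B)
    (ho : g =O[𝓝 0] fun x => ‖x‖ ^ k) :
    (∀ x, ‖x‖ < 1 → ‖g x‖ ≤ B * ‖x‖ ^ k) ∧ ∃ q : ℕ → ℂ, (∀ i ≤ k, ‖q i‖ ≤ B) ∧
      ∀ x, ‖x‖ < 1 → ‖g x - homPoly k q x‖ ≤ (k + 2) * B * ‖x‖ ^ (k + 1) := by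
  have hB0 : 0 ≤ B := (norm_nonneg _).trans (hB 0 (by simp))
  have schwarz : ∀ (m : ℕ) (g : ℂ × ℂ → ℂ) (B : ℝ), (∀ x, AnalyticAt ℂ g x) →
      (∀ x, ‖x‖ < 1 → ‖g x‖ ≤ B) → (g =O[𝓝 0] fun x => ‖x‖ ^ (m + 1)) →
      ∀ x, ‖x‖ < 1 → ‖g x‖ ≤ B * ‖x‖ ^ (m + 1) := by
    intro m g B hg hB ho x hx
    have hg0 : g 0 = 0 := by
      exact IsBigO.eq_zero_of_norm_pow (x₀ := 0) (n := m + 1) (by simpa using ho) (by omega)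
    have h := Complex.dist_le_mul_div_pow_of_mapsTo_ball_of_isLittleO (f := g) (c := 0) (z := x)
      (R₁ := 1) (R₂ := B) (n := m) (fun y _ => (hg y).differentiableAt.differentiableWithinAt)
      (fun y hy => by
        rw [hg0, mem_closedBall_zero_iff]
        exact hB y (mem_ball_zero_iff.1 hy))
      (by
        simp only [hg0, sub_zero]
        refine ho.trans_isLittleO ?_
        simpa using isLittleO_norm_pow_norm_pow (show m < m + 1 by omega))
      (mem_ball_zero_iff.2 hx)
    simpa [hg0] using h
  obtain ⟨m, rfl⟩ : ∃ m, k = m + 1 := ⟨k - 1, by omega⟩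
  have h1 := schwarz m g B hg hB ho
  obtain ⟨q, hq⟩ := exists_homPoly_isBigO (hg 0) ho
  have h2 := norm_le_of_isBigO_pow_succ h1 hq
  refine ⟨h1, q, fun i hi => norm_coeff_le_of_homPoly h2 hi, fun x hx => ?_⟩
  have h3 := schwarz (m + 1) (fun x => g x - homPoly (m + 1) q x) (2 * B)
    (fun x => (hg x).sub (analyticAt_homPoly _ _ _)) (fun x hx => ?_) hq x hx
  · refine h3.trans ?_
    have : (0 : ℝ) ≤ m := m.cast_nonneg
    gcongr
    push_cast
    linarith
  · have h4 : B * ‖x‖ ^ (m + 1) ≤ B :=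
      mul_le_of_le_one_right hB0 (pow_le_one₀ (norm_nonneg _) hx.le)
    linarith [norm_sub_le (g x) (homPoly (m + 1) q x), hB x hx, h2 x]

/-- The Taylor expansion of order `k` of a uniformly attracting map with diagonal linear part. -/
lemma exists_diag_approx {f : ℂ × ℂ → ℂ × ℂ} {C D : ℝ} {k : ℕ} (hk : 2 ≤ k) (hD : D < 1)
    (hf : ∀ x, AnalyticAt ℂ f x) (hf0 : f 0 = 0)
    (hCD : ∀ z : ℂ × ℂ, ‖z‖ < 1 → C * ‖z‖ ≤ ‖f z‖ ∧ ‖f z‖ ≤ D * ‖z‖)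
    (hcontact : OrderOfContact f k)
    (hdiag : ∃ a b : ℂ, ∀ z : ℂ × ℂ, fderiv ℂ f 0 z = (a * z.1, b * z.2)) :
    ∃ (a b : ℂ) (q q' : ℕ → ℂ), (C ≤ ‖a‖ ∧ ‖a‖ ≤ D) ∧ (C ≤ ‖b‖ ∧ ‖b‖ ≤ D) ∧
      (∀ i ≤ k, ‖q i‖ ≤ 2) ∧ (∀ i ≤ k, ‖q' i‖ ≤ 2) ∧
      ∀ x, ‖x‖ < 1 → ‖(f x).1 - a * x.1‖ ≤ 2 * ‖x‖ ^ k ∧ ‖(f x).2 - b * x.2‖ ≤ 2 * ‖x‖ ^ k ∧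
        ‖(f x).1 - a * x.1 - homPoly k q x‖ ≤ (k + 2) * 2 * ‖x‖ ^ (k + 1) ∧
        ‖(f x).2 - b * x.2 - homPoly k q' x‖ ≤ (k + 2) * 2 * ‖x‖ ^ (k + 1) := by
  obtain ⟨a, b, hab⟩ := hdiag
  obtain ⟨l, hl⟩ := hcontact
  have hder : HasFDerivAt f l 0 := by
    rw [hasFDerivAt_iff_isLittleO_nhds_zero]
    simp only [zero_add, hf0, sub_zero]
    exact hl.trans_isLittleO (isLittleO_norm_pow_id (by omega))
  have hl' : ∀ z, l z = (a * z.1, b * z.2) := by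
    intro z
    rw [← hab, hder.fderiv]
  have hlim : ∀ v, Tendsto (fun n : ℕ => ‖((n : ℂ) + 1) • f (((n : ℂ) + 1)⁻¹ • v)‖) atTop
      (𝓝 ‖l v‖) := by
    intro v
    have hc : Tendsto (fun n : ℕ => ‖(n : ℂ) + 1‖) atTop atTop := by
      have h1 : ∀ n : ℕ, ‖(n : ℂ) + 1‖ = n + 1 := fun n => by
        exact_mod_cast Complex.norm_natCast (n + 1)
      simp only [h1]
      exact tendsto_atTop_add_const_right _ _ tendsto_natCast_atTop_atTop
    have := hder.lim v hc
    simpa [hf0] using this.norm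
  have hbd : ∀ v : ℂ × ℂ, ‖v‖ = 1 → C ≤ ‖l v‖ ∧ ‖l v‖ ≤ D := by
    intro v hv
    have h1 : ∀ n : ℕ, 1 ≤ n → C ≤ ‖((n : ℂ) + 1) • f (((n : ℂ) + 1)⁻¹ • v)‖ ∧
        ‖((n : ℂ) + 1) • f (((n : ℂ) + 1)⁻¹ • v)‖ ≤ D := by
      intro n hn
      have h2 : ‖(n : ℂ) + 1‖ = n + 1 := by exact_mod_cast Complex.norm_natCast (n + 1)
      have h3 : (1 : ℝ) ≤ n := by exact_mod_cast hn
      have h4 : ‖((n : ℂ) + 1)⁻¹ • v‖ = ((n : ℝ) + 1)⁻¹ := by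
        rw [norm_smul, norm_inv, h2, hv, mul_one]
      have h5 := hCD (((n : ℂ) + 1)⁻¹ • v) (by
        rw [h4]; exact inv_lt_one_of_one_lt₀ (by linarith))
      rw [h4, ← div_eq_mul_inv, ← div_eq_mul_inv, div_le_iff₀ (by linarith),
        le_div_iff₀ (by linarith)] at h5
      rw [norm_smul, h2, mul_comm]
      exact h5
    exact ⟨ge_of_tendsto (hlim v) ((eventually_ge_atTop 1).mono fun n hn => (h1 n hn).1),
      le_of_tendsto (hlim v) ((eventually_ge_atTop 1).mono fun n hn => (h1 n hn).2)⟩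
  have ha := hbd (1, 0) (by simp [Prod.norm_def])
  have hb := hbd (0, 1) (by simp [Prod.norm_def])
  simp only [hl', Prod.norm_def, mul_one, mul_zero, norm_zero, norm_nonneg, sup_of_le_left,
    sup_of_le_right] at ha hb
  have hfle : ∀ x : ℂ × ℂ, ‖x‖ < 1 → ‖f x‖ ≤ 1 := fun x hx =>
    ((hCD x hx).2.trans (mul_le_mul_of_nonneg_right hD.le (norm_nonneg _))).trans (by linarith)
  have hmul : ∀ c t : ℂ, ‖c‖ ≤ D → ‖t‖ < 1 → ‖c * t‖ ≤ 1 := fun c t hc ht => by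
    rw [norm_mul]
    exact mul_le_one₀ (by linarith) (norm_nonneg _) ht.le
  have h1 := exists_homPoly_approx (k := k) (by omega) (g := fun x => (f x).1 - a * x.1) (B := 2)
    (fun x => (analyticAt_fst.fun_comp (hf x)).sub (analyticAt_const.mul analyticAt_fst))
    (fun x hx => by
      have := hmul a x.1 ha.2 ((norm_fst_le x).trans_lt hx)
      linarith [norm_sub_le (f x).1 (a * x.1), norm_fst_le (f x), hfle x hx])
    ((IsBigO.of_bound 1 (Eventually.of_forall fun z => by
      rw [one_mul]; simpa [hl'] using norm_fst_le (f z - l z))).trans hl)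
  have h2 := exists_homPoly_approx (k := k) (by omega) (g := fun x => (f x).2 - b * x.2) (B := 2)
    (fun x => (analyticAt_snd.fun_comp (hf x)).sub (analyticAt_const.mul analyticAt_snd))
    (fun x hx => by
      have := hmul b x.2 hb.2 ((norm_snd_le x).trans_lt hx)
      linarith [norm_sub_le (f x).2 (b * x.2), norm_snd_le (f x), hfle x hx])
    ((IsBigO.of_bound 1 (Eventually.of_forall fun z => by
      rw [one_mul]; simpa [hl'] using norm_snd_le (f z - l z))).trans hl)
  obtain ⟨h1, q, hq, hq1⟩ := h1
  obtain ⟨h2, q', hq', hq2⟩ := h2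
  exact ⟨a, b, q, q', ha, hb, hq, hq', fun x hx => ⟨h1 x hx, h2 x hx, hq1 x hx, hq2 x hx⟩⟩

/-- The exponents of the rescaling: they increase with full speed `ξ`, `η`, unless one of them
would become larger than `k` times the other. -/
lemma exists_weights {k : ℝ} (hk : 1 ≤ k) {ξ η : ℕ → ℝ} {L : ℝ} (hξ : ∀ n, 0 ≤ ξ n)
    (hη : ∀ n, 0 ≤ η n) (hξL : ∀ n, ξ n ≤ L) (hηL : ∀ n, η n ≤ L) :
    ∃ (σ τ : ℕ → ℝ) (S S' : Set ℕ), σ 0 = 1 ∧ τ 0 = 1 ∧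
      (∀ n, σ n ≤ σ (n + 1) ∧ σ (n + 1) ≤ σ n + ξ n ∧ σ (n + 1) ≤ k * τ n + k * L ∧
        σ (n + 1) ≤ k * σ n + k * L ∧ (n ∈ S → k * τ n ≤ σ (n + 1)) ∧
        (n ∉ S → σ (n + 1) = σ n + ξ n)) ∧
      (∀ n, τ n ≤ τ (n + 1) ∧ τ (n + 1) ≤ τ n + η n ∧ τ (n + 1) ≤ k * σ n + k * L ∧
        τ (n + 1) ≤ k * τ n + k * L ∧ (n ∈ S' → k * σ n ≤ τ (n + 1)) ∧
        (n ∉ S' → τ (n + 1) = τ n + η n)) ∧ Disjoint S S' := by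
  let step : ℕ → ℝ × ℝ → ℝ × ℝ := fun n p =>
    (min (p.1 + ξ n) (k * (p.2 + η n)), min (p.2 + η n) (k * (p.1 + ξ n)))
  let u : ℕ → ℝ × ℝ := fun n => Nat.rec (1, 1) step n
  have hσ : ∀ n, (u (n + 1)).1 = min ((u n).1 + ξ n) (k * ((u n).2 + η n)) := fun n => rfl
  have hτ : ∀ n, (u (n + 1)).2 = min ((u n).2 + η n) (k * ((u n).1 + ξ n)) := fun n => rfl
  have inv : ∀ n, 1 ≤ (u n).1 ∧ 1 ≤ (u n).2 ∧ (u n).1 ≤ k * (u n).2 ∧ (u n).2 ≤ k * (u n).1 := by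
    intro n
    induction n with
    | zero => exact ⟨le_rfl, le_rfl, by simpa [u] using hk, by simpa [u] using hk⟩
    | succ n ih =>
      obtain ⟨h1, h2, h3, h4⟩ := ih
      have h5 := hξ n
      have h6 := hη n
      have h7 : ∀ t : ℝ, 1 ≤ t → t ≤ k * t := fun t ht => by nlinarith
      rw [hσ, hτ, mul_min_of_nonneg _ _ (by linarith), mul_min_of_nonneg _ _ (by linarith)]
      have h8 := h7 ((u n).1 + ξ n) (by linarith)
      have h9 := h7 ((u n).2 + η n) (by linarith)
      have h10 := h7 _ (show 1 ≤ k * ((u n).1 + ξ n) by linarith)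
      have h11 := h7 _ (show 1 ≤ k * ((u n).2 + η n) by linarith)
      refine ⟨le_min (by linarith) (by linarith), le_min (by linarith) (by linarith),
        le_min (min_le_right _ _) ((min_le_left _ _).trans (by linarith)),
        le_min (min_le_right _ _) ((min_le_left _ _).trans (by linarith))⟩
  refine ⟨fun n => (u n).1, fun n => (u n).2, {n | k * ((u n).2 + η n) < (u n).1 + ξ n},
    {n | k * ((u n).1 + ξ n) < (u n).2 + η n}, rfl, rfl, fun n => ?_, fun n => ?_, ?_⟩
  · obtain ⟨h1, h2, h3, h4⟩ := inv n
    have h5 := mul_nonneg (show 0 ≤ k by linarith) (hη n)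
    have h6 := mul_le_mul_of_nonneg_left (hηL n) (show 0 ≤ k by linarith)
    have h7 : (u n).1 ≤ k * (u n).1 := by nlinarith
    have h8 : L ≤ k * L := by nlinarith [(hξ n).trans (hξL n)]
    simp only [hσ, mem_ofPred_eq, not_lt]
    refine ⟨le_min (by linarith [hξ n]) (by linarith), min_le_left _ _,
      (min_le_right _ _).trans (by linarith), (min_le_left _ _).trans (by linarith [hξL n]),
      fun h => ?_, fun h => min_eq_left h⟩
    rw [min_eq_right h.le]
    linarith
  · obtain ⟨h1, h2, h3, h4⟩ := inv n
    have h5 := mul_nonneg (show 0 ≤ k by linarith) (hξ n)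
    have h6 := mul_le_mul_of_nonneg_left (hξL n) (show 0 ≤ k by linarith)
    have h7 : (u n).2 ≤ k * (u n).2 := by nlinarith
    have h8 : L ≤ k * L := by nlinarith [(hξ n).trans (hξL n)]
    simp only [hτ, mem_ofPred_eq, not_lt]
    refine ⟨le_min (by linarith [hη n]) (by linarith), min_le_left _ _,
      (min_le_right _ _).trans (by linarith), (min_le_left _ _).trans (by linarith [hηL n]),
      fun h => ?_, fun h => min_eq_left h⟩
    rw [min_eq_right h.le]
    linarith
  · rw [Set.disjoint_left]
    intro n h1 h2
    simp only [mem_ofPred_eq] at h1 h2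
    obtain ⟨h3, h4, -⟩ := inv n
    nlinarith [hξ n, hη n]

lemma norm_rescale_coord {k : ℕ} {g : ℂ × ℂ → ℂ} {q : ℕ → ℂ} {B B' r θ : ℝ} {c u v : ℂ}
    (hB' : 0 ≤ B') (hr : r < 1) (hu : ‖u‖ ≤ r) (hv : ‖v‖ ≤ r) (hc : ‖c‖ * r ^ k ≤ θ)
    (hq : ∀ i ≤ k, ‖q i‖ ≤ B) (hg : ∀ x, ‖x‖ < 1 → ‖g x‖ ≤ B * ‖x‖ ^ k)
    (hg' : ∀ x, ‖x‖ < 1 → ‖g x - homPoly k q x‖ ≤ B' * ‖x‖ ^ (k + 1)) :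
    (∀ i ≤ k, ‖c * (u ^ i * v ^ (k - i) * q i)‖ ≤ B * θ) ∧
      ∀ x : ℂ × ℂ, ‖x‖ ≤ 1 → ‖c * g (u * x.1, v * x.2)‖ ≤ B * θ * ‖x‖ ^ k ∧
        ‖c * g (u * x.1, v * x.2) - homPoly k (fun i => c * (u ^ i * v ^ (k - i) * q i)) x‖ ≤
          B' * θ * ‖x‖ ^ (k + 1) := by
  have hr0 : 0 ≤ r := (norm_nonneg _).trans hu
  have hB : 0 ≤ B := (norm_nonneg _).trans (hq 0 (Nat.zero_le _))
  have hθ : 0 ≤ θ := (by positivity : 0 ≤ ‖c‖ * r ^ k).trans hc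
  refine ⟨fun i hi => ?_, fun x hx => ?_⟩
  · rw [norm_mul, norm_mul, norm_mul, norm_pow, norm_pow]
    have h1 : ‖u‖ ^ i * ‖v‖ ^ (k - i) ≤ r ^ k := by
      calc ‖u‖ ^ i * ‖v‖ ^ (k - i) ≤ r ^ i * r ^ (k - i) := by gcongr
        _ = r ^ k := by rw [← pow_add]; congr 1; omega
    calc ‖c‖ * (‖u‖ ^ i * ‖v‖ ^ (k - i) * ‖q i‖) ≤ ‖c‖ * (r ^ k * B) := by
          gcongr; exact hq i hi
      _ = B * (‖c‖ * r ^ k) := by ring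
      _ ≤ B * θ := by gcongr
  · have h1 : ‖((u * x.1, v * x.2) : ℂ × ℂ)‖ ≤ r * ‖x‖ := by
      rw [Prod.norm_def, norm_mul, norm_mul]
      exact max_le (mul_le_mul hu (norm_fst_le x) (norm_nonneg _) hr0)
        (mul_le_mul hv (norm_snd_le x) (norm_nonneg _) hr0)
    have h2 : ‖((u * x.1, v * x.2) : ℂ × ℂ)‖ < 1 :=
      h1.trans_lt ((mul_le_of_le_one_right hr0 hx).trans_lt hr)
    have h3 : homPoly k (fun i => c * (u ^ i * v ^ (k - i) * q i)) x =
        c * homPoly k q (u * x.1, v * x.2) := by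
      rw [homPoly_diag]
      simp only [homPoly, Finset.mul_sum]
      exact Finset.sum_congr rfl fun i _ => by ring
    rw [h3, ← mul_sub, norm_mul, norm_mul]
    constructor
    · calc ‖c‖ * ‖g (u * x.1, v * x.2)‖ ≤ ‖c‖ * (B * (r * ‖x‖) ^ k) := by
            gcongr
            exact (hg _ h2).trans (by gcongr)
        _ = B * (‖c‖ * r ^ k) * ‖x‖ ^ k := by ring
        _ ≤ B * θ * ‖x‖ ^ k := by gcongr
    · calc ‖c‖ * ‖g (u * x.1, v * x.2) - homPoly k q (u * x.1, v * x.2)‖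
            ≤ ‖c‖ * (B' * (r * ‖x‖) ^ (k + 1)) := by
            gcongr
            exact (hg' _ h2).trans (by gcongr)
        _ = B' * (‖c‖ * r ^ k) * ‖x‖ ^ (k + 1) * r := by ring
        _ ≤ B' * (‖c‖ * r ^ k) * ‖x‖ ^ (k + 1) * 1 := by gcongr
        _ ≤ B' * θ * ‖x‖ ^ (k + 1) := by rw [mul_one]; gcongr

lemma norm_coord_le_exp {k : ℕ} (hk : 2 ≤ k) {a y z : ℂ} {v : ℂ × ℂ}
    {D ε c d m μ μ' σ σ' : ℝ} (hD : 0 ≤ D) (hε : 0 < ε) (hε1 : ε < 1) (hc : 0 ≤ c) (hμ : 0 ≤ μ)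
    (hμ1 : μ ≤ 1) (hz : ‖z‖ ≤ ε * Real.exp (-(μ * σ))) (hv : ‖v‖ ≤ ε * Real.exp (-(μ * m)))
    (hy : ‖y - a * z‖ ≤ 2 * ‖v‖ ^ k) (ha : ‖a‖ ≤ D * Real.exp (-(σ' - σ))) (hσ : σ ≤ σ')
    (hm : σ' ≤ k * m + c) (hd : D + 2 * (ε * Real.exp c) ≤ Real.exp (-d))
    (hμd : (μ' - μ) * σ' ≤ d) : ‖y‖ ≤ ε * Real.exp (-(μ' * σ')) := by
  have h1 : ‖a‖ * ‖z‖ ≤ ε * Real.exp (-(μ * σ')) * D := by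
    have h2 : ‖a‖ ≤ D * Real.exp (-(μ * (σ' - σ))) := by
      refine ha.trans ?_
      gcongr
      nlinarith
    calc ‖a‖ * ‖z‖ ≤ (D * Real.exp (-(μ * (σ' - σ)))) * (ε * Real.exp (-(μ * σ))) := by gcongr
      _ = ε * (Real.exp (-(μ * (σ' - σ))) * Real.exp (-(μ * σ))) * D := by ring
      _ = ε * Real.exp (-(μ * σ')) * D := by
        rw [← Real.exp_add]
        ring_nf
  have h2 : ‖v‖ ^ k ≤ ε * Real.exp (-(μ * σ')) * (ε * Real.exp c) := by
    have h3 : ε ^ k ≤ ε ^ 2 := pow_le_pow_of_le_one hε.le hε1.le hk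
    calc ‖v‖ ^ k ≤ (ε * Real.exp (-(μ * m))) ^ k := by gcongr
      _ = ε ^ k * Real.exp (k * -(μ * m)) := by rw [mul_pow, Real.exp_nat_mul]
      _ ≤ ε ^ 2 * Real.exp (c - μ * σ') := by
        gcongr
        have h4 := mul_le_mul_of_nonneg_left hm hμ
        nlinarith
      _ = ε * Real.exp (-(μ * σ')) * (ε * Real.exp c) := by
        rw [sub_eq_add_neg, Real.exp_add]
        ring
  have h3 : ‖y‖ ≤ ‖a‖ * ‖z‖ + 2 * ‖v‖ ^ k := by
    have := norm_add_le (a * z) (y - a * z)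
    rw [add_sub_cancel, norm_mul] at this
    linarith
  calc ‖y‖ ≤ ε * Real.exp (-(μ * σ')) * (D + 2 * (ε * Real.exp c)) := by linarith
    _ ≤ ε * Real.exp (-(μ * σ')) * Real.exp (-d) := by gcongr
    _ = ε * Real.exp (-(μ * σ') + -d) := by rw [mul_assoc, ← Real.exp_add]
    _ ≤ ε * Real.exp (-(μ' * σ')) := by
      gcongr
      linarith

/-- An orbit tending to zero eventually satisfies the weighted estimates
`|z_n| ≤ ε exp (-σ n)`, `|w_n| ≤ ε exp (-τ n)`, provided the weights grow at most linearly. -/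
lemma exists_norm_orb_le_exp {k : ℕ} (hk : 2 ≤ k) {f : ℕ → ℂ × ℂ → ℂ × ℂ} {a b : ℕ → ℂ}
    {D ε c A : ℝ} {σ τ : ℕ → ℝ} (hD : 0 < D) (hε : 0 < ε) (hε1 : ε < 1) (hc : 0 ≤ c)
    (hA : 0 < A)
    (hf : ∀ n x, ‖x‖ < 1 → ‖(f n x).1 - a n * x.1‖ ≤ 2 * ‖x‖ ^ k ∧
      ‖(f n x).2 - b n * x.2‖ ≤ 2 * ‖x‖ ^ k)
    (ha : ∀ n, ‖a n‖ ≤ D * Real.exp (-(σ (n + 1) - σ n)))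
    (hb : ∀ n, ‖b n‖ ≤ D * Real.exp (-(τ (n + 1) - τ n)))
    (hσ0 : ∀ n, 0 ≤ σ n) (hτ0 : ∀ n, 0 ≤ τ n)
    (hσ : ∀ n, σ n ≤ σ (n + 1)) (hτ : ∀ n, τ n ≤ τ (n + 1))
    (hσm : ∀ n, σ (n + 1) ≤ k * min (σ n) (τ n) + c)
    (hτm : ∀ n, τ (n + 1) ≤ k * min (σ n) (τ n) + c)
    (hσA : ∀ n, σ (n + 1) ≤ A * (n + 1)) (hτA : ∀ n, τ (n + 1) ≤ A * (n + 1))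
    (hd : D + 2 * (ε * Real.exp c) < 1) {x : ℂ × ℂ}
    (hx : Tendsto (fun n => orb f n x) atTop (𝓝 0)) :
    ∃ n, ‖(orb f n x).1‖ ≤ ε * Real.exp (-σ n) ∧ ‖(orb f n x).2‖ ≤ ε * Real.exp (-τ n) := by
  obtain ⟨n₀, hn₀⟩ := (hx.eventually (closedBall_mem_nhds 0 hε)).exists
  rw [dist_zero_right] at hn₀
  set d := -Real.log (D + 2 * (ε * Real.exp c)) with hd'
  have hpos : 0 < D + 2 * (ε * Real.exp c) := by positivity
  have hd0 : 0 < d := by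
    rw [hd', neg_pos]
    exact Real.log_neg hpos hd
  have hed : D + 2 * (ε * Real.exp c) ≤ Real.exp (-d) := by
    rw [hd', neg_neg, Real.exp_log hpos]
  set H : ℕ → ℝ := fun n => ∑ i ∈ Finset.range n, (1 / ((i : ℝ) + 1)) with hH
  have hHs : ∀ n, H (n + 1) = H n + 1 / ((n : ℝ) + 1) := fun n => Finset.sum_range_succ _ _
  have hHm : Monotone H := monotone_nat_of_le_succ fun n => by
    rw [hHs]
    have : (0 : ℝ) ≤ 1 / ((n : ℝ) + 1) := by positivity
    linarith
  set μ : ℕ → ℝ := fun n => min 1 (d / A * (H n - H n₀)) with hμ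
  have key : ∀ n, n₀ ≤ n → ‖(orb f n x).1‖ ≤ ε * Real.exp (-(μ n * σ n)) ∧
      ‖(orb f n x).2‖ ≤ ε * Real.exp (-(μ n * τ n)) := by
    intro n hn
    induction n, hn using Nat.le_induction with
    | base =>
      have h0 : μ n₀ = 0 := by simp [hμ]
      simp only [h0, zero_mul, neg_zero, Real.exp_zero, mul_one]
      exact ⟨(norm_fst_le _).trans hn₀, (norm_snd_le _).trans hn₀⟩
    | succ n hn ih =>
      have hμ0 : 0 ≤ μ n :=
        le_min zero_le_one (mul_nonneg (by positivity) (sub_nonneg.2 (hHm hn)))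
      have hμ1 : μ n ≤ 1 := min_le_left _ _
      have hμ2 : μ (n + 1) - μ n ≤ d / A * (1 / ((n : ℝ) + 1)) := by
        have hp : 0 ≤ d / A * (1 / ((n : ℝ) + 1)) := by positivity
        have : μ (n + 1) ≤ μ n + d / A * (1 / ((n : ℝ) + 1)) := by
          simp only [hμ, hHs]
          rw [min_add]
          refine min_le_min (by linarith) (le_of_eq (by ring))
        linarith
      have hd2 : ∀ s, 0 ≤ s → s ≤ A * ((n : ℝ) + 1) → (μ (n + 1) - μ n) * s ≤ d := by
        intro s hs hs'
        have hp : 0 ≤ d / A * (1 / ((n : ℝ) + 1)) := by positivity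
        calc (μ (n + 1) - μ n) * s ≤ d / A * (1 / ((n : ℝ) + 1)) * (A * ((n : ℝ) + 1)) :=
              (mul_le_mul_of_nonneg_right hμ2 hs).trans (mul_le_mul_of_nonneg_left hs' hp)
          _ = d := by field_simp
      have hv : ‖orb f n x‖ ≤ ε * Real.exp (-(μ n * min (σ n) (τ n))) := by
        rw [Prod.norm_def]
        refine max_le (ih.1.trans ?_) (ih.2.trans ?_)
        · gcongr; exact min_le_left _ _
        · gcongr; exact min_le_right _ _
      have hv1 : ‖orb f n x‖ < 1 := by
        refine hv.trans_lt ((mul_le_of_le_one_right hε.le ?_).trans_lt hε1)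
        rw [Real.exp_le_one_iff, neg_nonpos]
        exact mul_nonneg hμ0 (le_min (hσ0 n) (hτ0 n))
      have h1 := hf n _ hv1
      exact ⟨norm_coord_le_exp hk hD.le hε hε1 hc hμ0 hμ1 ih.1 hv h1.1 (ha n) (hσ n) (hσm n) hed
          (hd2 _ (hσ0 _) (hσA n)),
        norm_coord_le_exp hk hD.le hε hε1 hc hμ0 hμ1 ih.2 hv h1.2 (hb n) (hτ n) (hτm n) hed
          (hd2 _ (hτ0 _) (hτA n))⟩
  obtain ⟨n, hn⟩ := exists_sum_one_div_gt (A / d + H n₀)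
  have hn' : A / d + H n₀ < H n := hn
  have hnn : n₀ ≤ n := by
    by_contra! h
    have := hHm h.le
    have : 0 < A / d := by positivity
    linarith
  have hμn : μ n = 1 := by
    refine min_eq_left ?_
    have : A / d ≤ H n - H n₀ := by linarith
    calc (1 : ℝ) = d / A * (A / d) := by field_simp
      _ ≤ _ := by gcongr
  have := key n hnn
  rw [hμn, one_mul, one_mul] at this
  exact ⟨n, this⟩

lemma exists_consts {k : ℕ} {C D : ℝ} (hC : 0 < C) (hD : D < 1)
    (hDC : D ^ (k + 1) < C) :
    ∃ δ κ, 0 < κ ∧ δ < 1 ∧ D + κ * (1 + 1 / (C * (1 - D))) ≤ δ ∧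
      (1 + κ * (1 + 1 / (C * (1 - D))) * k / C ^ k) / C * δ ^ (k + 1) < 1 := by
  have hcont : Continuous fun κ : ℝ => (D + κ * (1 + 1 / (C * (1 - D)))) := by fun_prop
  have hcont' : Continuous fun κ : ℝ => (1 + κ * (1 + 1 / (C * (1 - D))) * k / C ^ k) / C *
      (D + κ * (1 + 1 / (C * (1 - D)))) ^ (k + 1) := by fun_prop
  have h1 : ∀ᶠ κ : ℝ in 𝓝[>] 0, D + κ * (1 + 1 / (C * (1 - D))) < 1 :=
    nhdsWithin_le_nhds (hcont.continuousAt.eventually_lt continuousAt_const (by simpa using hD))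
  have h2 : ∀ᶠ κ : ℝ in 𝓝[>] 0, (1 + κ * (1 + 1 / (C * (1 - D))) * k / C ^ k) / C *
      (D + κ * (1 + 1 / (C * (1 - D)))) ^ (k + 1) < 1 :=
    nhdsWithin_le_nhds (hcont'.continuousAt.eventually_lt continuousAt_const (by
      simp only [zero_mul, zero_div, add_zero]
      rw [one_div, inv_mul_lt_iff₀ hC, mul_one]
      exact hDC))
  obtain ⟨κ, h3, h4, h5⟩ := (h1.and (h2.and self_mem_nhdsWithin)).exists
  exact ⟨_, κ, h5, h3, le_rfl, h4⟩

/-- The diagonal linear map `(z, w) ↦ (a z, b w)`. -/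
def diagMap (a b : ℂ) (x : ℂ × ℂ) : ℂ × ℂ := (a * x.1, b * x.2)

lemma analyticAt_diagMap (a b : ℂ) (x : ℂ × ℂ) : AnalyticAt ℂ (diagMap a b) x :=
  (analyticAt_const.mul analyticAt_fst).prod (analyticAt_const.mul analyticAt_snd)

lemma diagMap_inv_diagMap {a b : ℂ} (ha : a ≠ 0) (hb : b ≠ 0) (x : ℂ × ℂ) :
    diagMap a⁻¹ b⁻¹ (diagMap a b x) = x := by
  simp [diagMap, ha, hb]

lemma diagMap_diagMap_inv {a b : ℂ} (ha : a ≠ 0) (hb : b ≠ 0) (x : ℂ × ℂ) :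
    diagMap a b (diagMap a⁻¹ b⁻¹ x) = x := by
  simp [diagMap, ha, hb]

lemma norm_diagMap_le {a b : ℂ} {r : ℝ} (ha : ‖a‖ ≤ r) (hb : ‖b‖ ≤ r) (x : ℂ × ℂ) :
    ‖diagMap a b x‖ ≤ r * ‖x‖ := by
  have hr : 0 ≤ r := (norm_nonneg _).trans ha
  rw [diagMap, Prod.norm_def, norm_mul, norm_mul]
  exact max_le (mul_le_mul ha (norm_fst_le x) (norm_nonneg _) hr)
    (mul_le_mul hb (norm_snd_le x) (norm_nonneg _) hr)

lemma BiholomorphicTo.preimage {U V : Set (ℂ × ℂ)} (h : BiholomorphicTo U V)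
    {S T : ℂ × ℂ → ℂ × ℂ} (hS : ∀ x, AnalyticAt ℂ S x) (hT : ∀ x, AnalyticAt ℂ T x)
    (hl : Function.LeftInverse T S) (hr : Function.RightInverse T S) :
    BiholomorphicTo (S ⁻¹' U) V := by
  obtain ⟨Φ, Ψ, hΦ, hΨ, hm, hm', h1, h2⟩ := h
  refine ⟨Φ ∘ S, T ∘ Ψ, fun x hx => ?_, fun x hx => ?_, fun x hx => hm hx, fun x hx => ?_,
    fun x hx => ?_, fun x hx => ?_⟩
  · exact (hΦ (S x) hx).comp (hS x).analyticWithinAt fun y hy => hy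
  · exact (hT (Ψ x)).comp_analyticWithinAt (hΨ x hx)
  · rw [mem_preimage, Function.comp_apply, hr]
    exact hm' hx
  · simp only [Function.comp_apply]
    rw [h1 _ hx, hl]
  · simp only [Function.comp_apply]
    rw [hr, h2 _ hx]

lemma mem_basin_iff {f : ℕ → ℂ × ℂ → ℂ × ℂ} {x : ℂ × ℂ} :
    x ∈ basin f ↔ Tendsto (fun n => orb f n x) atTop (𝓝 0) := by
  have h : ∀ n, seqComp f n = orb f (n + 1) := by
    intro n
    induction n with
    | zero => rfl
    | succ n ih => rw [seqComp, ih]; rfl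
  simp only [basin, mem_ofPred_eq, h]
  exact tendsto_add_atTop_iff_nat (f := fun n => orb f n x) 1

lemma tendsto_orb_zero {F : ℕ → ℂ × ℂ → ℂ × ℂ} {δ : ℝ} (hδ0 : 0 ≤ δ) (hδ : δ < 1)
    (hF : ∀ n x, ‖x‖ ≤ 1 → ‖F n x‖ ≤ δ * ‖x‖) {x : ℂ × ℂ} {n : ℕ} (hx : ‖orb F n x‖ ≤ 1) :
    Tendsto (fun m => orb F m x) atTop (𝓝 0) := by
  have h : ∀ m, ‖orb F (m + n) x‖ ≤ δ ^ m := by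
    intro m
    induction m with
    | zero => simpa using hx
    | succ m ih =>
      rw [show m + 1 + n = (m + n) + 1 by omega, pow_succ']
      exact (hF _ _ (ih.trans (pow_le_one₀ hδ0 hδ.le))).trans
        (mul_le_mul_of_nonneg_left ih hδ0)
  rw [← tendsto_add_atTop_iff_nat n]
  exact squeeze_zero_norm h (tendsto_pow_atTop_nhds_zero_of_lt_one hδ0 hδ)

/-- The basin of `f` corresponds to the basin of a rescaled sequence `F`. -/
lemma basin_eq_preimage {f F : ℕ → ℂ × ℂ → ℂ × ℂ} {c d : ℕ → ℂ} {δ ρ : ℝ} (hδ0 : 0 ≤ δ)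
    (hδ : δ < 1) (hρ : 0 < ρ) (hρ1 : ρ ≤ 1) (hc : ∀ n, 1 ≤ ‖c n‖) (hd : ∀ n, 1 ≤ ‖d n‖)
    (hF : ∀ n x, ‖x‖ ≤ 1 → ‖F n x‖ ≤ δ * ‖x‖)
    (hFf : ∀ n x, F n (diagMap (c n) (d n) x) = diagMap (c (n + 1)) (d (n + 1)) (f n x))
    (h : ∀ x, Tendsto (fun n => orb f n x) atTop (𝓝 0) →
      ∃ n, ‖diagMap (c n) (d n) (orb f n x)‖ ≤ 1) :
    basin f = diagMap (c 0) (d 0) ⁻¹' {x | ∃ n, orb F n x ∈ ball 0 ρ} := by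
  have horb : ∀ n x, orb F n (diagMap (c 0) (d 0) x) = diagMap (c n) (d n) (orb f n x) := by
    intro n x
    induction n with
    | zero => rfl
    | succ n ih => rw [orb, Function.comp_apply, ih, hFf]; rfl
  ext x
  rw [mem_basin_iff]
  simp only [mem_preimage, mem_ofPred_eq, mem_ball_zero_iff]
  constructor
  · intro hx
    obtain ⟨n, hn⟩ := h x hx
    rw [← horb] at hn
    exact exists_norm_orb_lt hδ0 hδ hρ hF hn
  · rintro ⟨n, hn⟩
    have h1 := tendsto_orb_zero hδ0 hδ hF (hn.le.trans hρ1)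
    refine squeeze_zero_norm (fun m => ?_) (tendsto_zero_iff_norm_tendsto_zero.1 h1)
    have hc0 : c m ≠ 0 := norm_pos_iff.1 (one_pos.trans_le (hc m))
    have hd0 : d m ≠ 0 := norm_pos_iff.1 (one_pos.trans_le (hd m))
    rw [horb]
    have := norm_diagMap_le (a := (c m)⁻¹) (b := (d m)⁻¹) (r := 1)
      (by rw [norm_inv]; exact inv_le_one_of_one_le₀ (hc m))
      (by rw [norm_inv]; exact inv_le_one_of_one_le₀ (hd m)) (diagMap (c m) (d m) (orb f m x))
    rwa [diagMap_inv_diagMap hc0 hd0, one_mul] at this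

/-- Theorem: if a uniformly attracting sequence of automorphisms of ℂ² has order of
contact `k`, diagonal linear parts, and `D^(k+1) < C`, then its basin is biholomorphic
to ℂ². -/
theorem basin_biholomorphic_of_diagonal
    (f : ℕ → (ℂ × ℂ) → (ℂ × ℂ)) (C D : ℝ) (k : ℕ)
    (hC : 0 < C) (hCD : C < D) (hD : D < 1) (hk : 2 ≤ k)
    (haut : ∀ n, IsAutomorphism (f n))
    (hattr : UniformlyAttracting f C D)
    (hcontact : ∀ n, OrderOfContact (f n) k)
    (hdiag : ∀ n, ∃ a b : ℂ, ∀ z : ℂ × ℂ, fderiv ℂ (f n) 0 z = (a * z.1, b * z.2))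
    (hDC : D ^ (k + 1) < C) :
    BiholomorphicTo (basin f) Set.univ := by
  have hD0 : 0 < D := hC.trans hCD
  choose hfa fi hfia hfl hfr using haut
  have hfa' : ∀ n x, AnalyticAt ℂ (f n) x := fun n x => analyticWithinAt_univ.1 (hfa n x trivial)
  have hfia' : ∀ n x, AnalyticAt ℂ (fi n) x :=
    fun n x => analyticWithinAt_univ.1 (hfia n x trivial)
  choose a b q q' ha hb hq hq' hf using fun n =>
    exists_diag_approx hk hD (hfa' n) (hattr.1 n) (hattr.2 n) (hcontact n) (hdiag n)
  have ha0 : ∀ n, 0 < ‖a n‖ := fun n => hC.trans_le (ha n).1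
  have hb0 : ∀ n, 0 < ‖b n‖ := fun n => hC.trans_le (hb n).1
  obtain ⟨δ, κ, hκ, hδ, hDδ, hCδ⟩ := exists_consts (k := k) hC hD hDC
  have hκδ : D + κ ≤ δ := by
    have : 0 ≤ κ * (1 / (C * (1 - D))) := by
      have : 0 < 1 - D := by linarith
      positivity
    linarith
  have hδ0 : 0 ≤ δ := by linarith
  -- the exponents
  set L := Real.log (D / C) with hL
  have hL0 : 0 < L := Real.log_pos ((one_lt_div hC).2 hCD)
  have hk1 : (1 : ℝ) ≤ k := by exact_mod_cast (by omega : 1 ≤ k)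
  have hlog : ∀ {t : ℝ}, 0 < t → C ≤ t ∧ t ≤ D →
      0 ≤ Real.log (D / t) ∧ Real.log (D / t) ≤ L ∧ t * Real.exp (Real.log (D / t)) = D := by
    intro t ht htD
    refine ⟨Real.log_nonneg ((one_le_div ht).2 htD.2),
      Real.log_le_log (by positivity) (by gcongr; exact htD.1), ?_⟩
    rw [Real.exp_log (by positivity)]
    field_simp
  obtain ⟨σ, τ, S, S', hσ0, hτ0, hσ, hτ, hSS'⟩ := exists_weights hk1
    (fun n => (hlog (ha0 n) (ha n)).1) (fun n => (hlog (hb0 n) (hb n)).1)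
    (fun n => (hlog (ha0 n) (ha n)).2.1) (fun n => (hlog (hb0 n) (hb n)).2.1)
  have growth : ∀ u : ℕ → ℝ, u 0 = 1 → (∀ n, u n ≤ u (n + 1)) → (∀ n, u (n + 1) ≤ u n + L) →
      (∀ n, 1 ≤ u n) ∧ ∀ n, u (n + 1) ≤ (1 + L) * (n + 1) := by
    intro u h0 h1 h2
    have h3 : ∀ n : ℕ, u n ≤ 1 + L * n := by
      intro n
      induction n with
      | zero => simp [h0]
      | succ n ih => push_cast; linarith [h2 n]
    refine ⟨fun n => h0 ▸ monotone_nat_of_le_succ h1 (Nat.zero_le n), fun n => ?_⟩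
    have := h3 (n + 1)
    push_cast at this
    have hn : (0 : ℝ) ≤ n := n.cast_nonneg
    linarith
  obtain ⟨hσ1, hσA⟩ := growth σ hσ0 (fun n => (hσ n).1)
    fun n => (hσ n).2.1.trans (by linarith [(hlog (ha0 n) (ha n)).2.1])
  obtain ⟨hτ1, hτA⟩ := growth τ hτ0 (fun n => (hτ n).1)
    fun n => (hτ n).2.1.trans (by linarith [(hlog (hb0 n) (hb n)).2.1])
  have hσm : ∀ n, σ (n + 1) ≤ k * min (σ n) (τ n) + k * L := fun n => by
    rcases min_choice (σ n) (τ n) with h | h <;> rw [h]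
    exacts [(hσ n).2.2.2.1, (hσ n).2.2.1]
  have hτm : ∀ n, τ (n + 1) ≤ k * min (σ n) (τ n) + k * L := fun n => by
    rcases min_choice (σ n) (τ n) with h | h <;> rw [h]
    exacts [(hτ n).2.2.1, (hτ n).2.2.2.1]
  -- the rescaling
  obtain ⟨ε, hε, hε1, hεκ⟩ : ∃ ε : ℝ, 0 < ε ∧ ε < 1 ∧ 2 * (ε * Real.exp (k * L)) ≤ κ := by
    refine ⟨min (1 / 2) (κ / (2 * Real.exp (k * L))), by positivity,
      (min_le_left _ _).trans_lt (by norm_num), ?_⟩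
    calc 2 * (min (1 / 2) (κ / (2 * Real.exp (k * L))) * Real.exp (k * L))
        ≤ 2 * (κ / (2 * Real.exp (k * L)) * Real.exp (k * L)) := by gcongr; exact min_le_right _ _
      _ = κ := by field_simp
  set θ := ε * Real.exp (k * L) with hθ
  set c : ℕ → ℂ := fun n => ((ε⁻¹ * Real.exp (σ n) : ℝ) : ℂ) with hc
  set d : ℕ → ℂ := fun n => ((ε⁻¹ * Real.exp (τ n) : ℝ) : ℂ) with hd
  have hcn : ∀ n, ‖c n‖ = ε⁻¹ * Real.exp (σ n) := fun n => by
    rw [hc, Complex.norm_real, Real.norm_of_nonneg (by positivity)]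
  have hdn : ∀ n, ‖d n‖ = ε⁻¹ * Real.exp (τ n) := fun n => by
    rw [hd, Complex.norm_real, Real.norm_of_nonneg (by positivity)]
  have hc0 : ∀ n, c n ≠ 0 := fun n => norm_pos_iff.1 (by rw [hcn]; positivity)
  have hd0 : ∀ n, d n ≠ 0 := fun n => norm_pos_iff.1 (by rw [hdn]; positivity)
  set r : ℕ → ℝ := fun n => ε * Real.exp (-min (σ n) (τ n)) with hr
  have hr1 : ∀ n, r n < 1 := fun n => by
    refine (mul_le_of_le_one_right hε.le ?_).trans_lt hε1
    rw [Real.exp_le_one_iff, neg_nonpos]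
    exact zero_le_one.trans (le_min (hσ1 n) (hτ1 n))
  have hcr : ∀ n, ‖(c n)⁻¹‖ ≤ r n := fun n => by
    rw [norm_inv, hcn, mul_inv, inv_inv, ← Real.exp_neg]
    simp only [hr]
    gcongr
    exact min_le_left _ _
  have hdr : ∀ n, ‖(d n)⁻¹‖ ≤ r n := fun n => by
    rw [norm_inv, hdn, mul_inv, inv_inv, ← Real.exp_neg]
    simp only [hr]
    gcongr
    exact min_le_right _ _
  have hθr : ∀ s n, s ≤ k * min (σ n) (τ n) + k * L → ε⁻¹ * Real.exp s * r n ^ k ≤ θ := by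
    intro s n hs
    calc ε⁻¹ * Real.exp s * r n ^ k
        = ε⁻¹ * ε ^ k * (Real.exp s * Real.exp (k * -min (σ n) (τ n))) := by
          simp only [hr]
          rw [mul_pow, Real.exp_nat_mul]
          ring
      _ = ε⁻¹ * ε ^ k * Real.exp (s + k * -min (σ n) (τ n)) := by rw [Real.exp_add]
      _ ≤ ε⁻¹ * ε ^ 2 * Real.exp (k * L) := by
          have := pow_le_pow_of_le_one hε.le hε1.le hk
          gcongr
          linarith
      _ = θ := by
          rw [hθ]
          field_simp
  set α : ℕ → ℂ := fun n => c (n + 1) * a n * (c n)⁻¹ with hα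
  set β : ℕ → ℂ := fun n => d (n + 1) * b n * (d n)⁻¹ with hβ
  have hαn : ∀ n, ‖α n‖ = ‖a n‖ * Real.exp (σ (n + 1) - σ n) := fun n => by
    simp only [hα]
    rw [norm_mul, norm_mul, norm_inv, hcn, hcn, Real.exp_sub]
    field_simp
  have hβn : ∀ n, ‖β n‖ = ‖b n‖ * Real.exp (τ (n + 1) - τ n) := fun n => by
    simp only [hβ]
    rw [norm_mul, norm_mul, norm_inv, hdn, hdn, Real.exp_sub]
    field_simp
  have hαC : ∀ n, C ≤ ‖α n‖ := fun n => by
    rw [hαn]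
    exact (ha n).1.trans (le_mul_of_one_le_right (ha0 n).le
      (Real.one_le_exp (sub_nonneg.2 (hσ n).1)))
  have hβC : ∀ n, C ≤ ‖β n‖ := fun n => by
    rw [hβn]
    exact (hb n).1.trans (le_mul_of_one_le_right (hb0 n).le
      (Real.one_le_exp (sub_nonneg.2 (hτ n).1)))
  have hαD : ∀ n, ‖α n‖ ≤ D := fun n => by
    rw [hαn, ← (hlog (ha0 n) (ha n)).2.2]
    gcongr
    linarith [(hσ n).2.1]
  have hβD : ∀ n, ‖β n‖ ≤ D := fun n => by
    rw [hβn, ← (hlog (hb0 n) (hb n)).2.2]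
    gcongr
    linarith [(hτ n).2.1]
  have hpowD : ∀ t : ℝ, 0 ≤ t → t ≤ D → t ^ k ≤ D * D := fun t ht htD => by
    rw [← pow_two]
    exact (pow_le_pow_left₀ ht htD k).trans (pow_le_pow_of_le_one hD0.le hD.le hk)
  set F : ℕ → ℂ × ℂ → ℂ × ℂ := fun n x =>
    diagMap (c (n + 1)) (d (n + 1)) (f n (diagMap (c n)⁻¹ (d n)⁻¹ x)) with hF
  set Fi : ℕ → ℂ × ℂ → ℂ × ℂ := fun n x =>
    diagMap (c n) (d n) (fi n (diagMap (c (n + 1))⁻¹ (d (n + 1))⁻¹ x)) with hFi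
  have hF1 : ∀ n x, (F n x).1 - α n * x.1 =
      c (n + 1) * ((f n ((c n)⁻¹ * x.1, (d n)⁻¹ * x.2)).1 - a n * ((c n)⁻¹ * x.1)) := by
    intro n x
    simp only [hF, hα, diagMap]
    ring
  have hF2 : ∀ n x, (F n x).2 - β n * x.2 =
      d (n + 1) * ((f n ((c n)⁻¹ * x.1, (d n)⁻¹ * x.2)).2 - b n * ((d n)⁻¹ * x.2)) := by
    intro n x
    simp only [hF, hβ, diagMap]
    ring
  have hB : (0 : ℝ) ≤ (k + 2) * 2 := by positivity
  have h1 := fun n => norm_rescale_coord (g := fun x => (f n x).1 - a n * x.1) (q := q n)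
    (B := 2) (B' := (k + 2) * 2) (c := c (n + 1)) hB (hr1 n) (hcr n) (hdr n)
    ((hcn (n + 1)).symm ▸ hθr _ n (hσm n)) (hq n) (fun x hx => (hf n x hx).1)
    (fun x hx => (hf n x hx).2.2.1)
  have h2 := fun n => norm_rescale_coord (g := fun x => (f n x).2 - b n * x.2) (q := q' n)
    (B := 2) (B' := (k + 2) * 2) (c := d (n + 1)) hB (hr1 n) (hcr n) (hdr n)
    ((hdn (n + 1)).symm ▸ hθr _ n (hτm n)) (hq' n) (fun x hx => (hf n x hx).2.1)
    (fun x hx => (hf n x hx).2.2.2)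
  simp only [← hF1] at h1
  simp only [← hF2] at h2
  have hcoord : ∀ {x : ℂ × ℂ} {y e t : ℂ}, ‖x‖ ≤ 1 → ‖e‖ ≤ D → ‖t‖ ≤ ‖x‖ →
      ‖y - e * t‖ ≤ 2 * θ * ‖x‖ ^ k → ‖y‖ ≤ δ * ‖x‖ := by
    intro x y e t hx he ht hy
    have h3 : ‖x‖ ^ k ≤ ‖x‖ := pow_le_of_le_one (norm_nonneg _) hx (by omega)
    have h4 := norm_add_le (e * t) (y - e * t)
    rw [add_sub_cancel, norm_mul] at h4
    have h5 : ‖e‖ * ‖t‖ ≤ D * ‖x‖ := mul_le_mul he ht (norm_nonneg _) hD0.le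
    have h6 : 2 * θ * ‖x‖ ^ k ≤ κ * ‖x‖ := mul_le_mul hεκ h3 (by positivity) hκ.le
    calc ‖y‖ ≤ (D + κ) * ‖x‖ := by linarith
      _ ≤ δ * ‖x‖ := by gcongr
  have hFδ : ∀ n x, ‖x‖ ≤ 1 → ‖F n x‖ ≤ δ * ‖x‖ := fun n x hx =>
    norm_prod_le_iff.2 ⟨hcoord hx (hαD n) (norm_fst_le x) ((h1 n).2 x hx).1,
      hcoord hx (hβD n) (norm_snd_le x) ((h2 n).2 x hx).1⟩
  obtain ⟨ρ, hρ, hρ1, hbih⟩ := biholomorphicTo_of_weighted hk (κ₁ := (k + 2) * 2 * θ) hC hD0 hD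
    hκ.le (by positivity) hδ hDδ hCδ (F := F) (Fi := Fi)
    (fun n x => (analyticAt_diagMap _ _ _).comp ((hfa' n _).comp (analyticAt_diagMap _ _ x)))
    (fun n x => (analyticAt_diagMap _ _ _).comp ((hfia' n _).comp (analyticAt_diagMap _ _ x)))
    (fun n x => by
      simp only [hF, hFi]
      rw [diagMap_inv_diagMap (hc0 _) (hd0 _), hfl, diagMap_diagMap_inv (hc0 _) (hd0 _)])
    (fun n x => by
      simp only [hF, hFi]
      rw [diagMap_inv_diagMap (hc0 _) (hd0 _), hfr, diagMap_diagMap_inv (hc0 _) (hd0 _)])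
    hFδ hαC hβC hαD hβD
    (S := S) (S' := S') (σ := σ) (τ := τ) (A := 1 + L)
    (fun n hn => by
      have : ‖α n‖ = D := by
        rw [hαn, (hσ n).2.2.2.2.2 hn, add_sub_cancel_left, (hlog (ha0 n) (ha n)).2.2]
      rw [this]
      exact hpowD _ (norm_nonneg _) (hβD n))
    (fun n hn => by
      have : ‖β n‖ = D := by
        rw [hβn, (hτ n).2.2.2.2.2 hn, add_sub_cancel_left, (hlog (hb0 n) (hb n)).2.2]
      rw [this]
      exact hpowD _ (norm_nonneg _) (hαD n))
    hSS' (fun n i hi => ((h1 n).1 i hi).trans hεκ) (fun n i hi => ((h2 n).1 i hi).trans hεκ)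
    (fun n x hx => by
      refine norm_prod_le_iff.2 ⟨?_, ?_⟩
      · simpa only [Prod.fst_sub, sub_sub] using ((h1 n).2 x hx).2
      · simpa only [Prod.snd_sub, sub_sub] using ((h2 n).2 x hx).2)
    (fun n hn => (hσ n).2.2.2.2.1 hn) (fun n hn => (hτ n).2.2.2.2.1 hn) hσ0.ge hτ0.ge
    (fun n => (hσ n).1) (fun n => (hτ n).1) (by linarith) hσA hτA
  have hinv : 1 ≤ ε⁻¹ := (one_le_inv₀ hε).2 hε1.le
  rw [basin_eq_preimage (c := c) (d := d) (F := F) hδ0 hδ hρ hρ1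
    (fun n => by
      rw [hcn]
      exact one_le_mul_of_one_le_of_one_le hinv (Real.one_le_exp (by linarith [hσ1 n])))
    (fun n => by
      rw [hdn]
      exact one_le_mul_of_one_le_of_one_le hinv (Real.one_le_exp (by linarith [hτ1 n])))
    hFδ (fun n x => by
      simp only [hF]
      rw [diagMap_inv_diagMap (hc0 _) (hd0 _)])
    fun x hx => ?_]
  · exact hbih.preimage (analyticAt_diagMap _ _) (analyticAt_diagMap (c 0)⁻¹ (d 0)⁻¹)
      (diagMap_inv_diagMap (hc0 _) (hd0 _)) (diagMap_diagMap_inv (hc0 _) (hd0 _))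
  · obtain ⟨n, hn1, hn2⟩ := exists_norm_orb_le_exp hk (c := k * L) (σ := σ) (τ := τ) hD0 hε hε1
      (by positivity) (by linarith : 0 < 1 + L) (fun n x hx => ⟨(hf n x hx).1, (hf n x hx).2.1⟩)
      (fun n => by
        rw [Real.exp_neg, ← div_eq_mul_inv, le_div_iff₀ (Real.exp_pos _), ← hαn]
        exact hαD n)
      (fun n => by
        rw [Real.exp_neg, ← div_eq_mul_inv, le_div_iff₀ (Real.exp_pos _), ← hβn]
        exact hβD n)
      (fun n => zero_le_one.trans (hσ1 n)) (fun n => zero_le_one.trans (hτ1 n))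
      (fun n => (hσ n).1) (fun n => (hτ n).1) hσm hτm hσA hτA (by linarith) hx
    have hone : ∀ s, ε⁻¹ * Real.exp s * (ε * Real.exp (-s)) = 1 := fun s => by
      rw [Real.exp_neg]
      field_simp
    refine ⟨n, norm_prod_le_iff.2 ⟨?_, ?_⟩⟩
    · rw [diagMap, norm_mul, hcn, ← hone (σ n)]
      gcongr
    · rw [diagMap, norm_mul, hdn, ← hone (τ n)]
      gcongr
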